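/- arXiv:2308.01782 — 2 statements merged into one kernel-verified Lean document; each statement's English description precedes it below -/
import Mathlib

section
/- Let n ≥ 1, R > 0, 1 < p < ∞, b > 1, a < n and 0 < c ≤ (n-a)/(b-1). Then for every real-valued function f ∈ C_0^1(B(0,R)\{0}) one has ((b-1)c/p)^p · ∫_{B(0,R)} |f(x)|^p / (|x|^a (1-(|x|/R)^c)^b) dx ≤ ∫_{B(0,R)} |∇f(x)|^p / (|x|^{a-p} (1-(|x|/R)^c)^{b-p}) dx, where ∇f is the gradient of f and |∇f(x)| its Euclidean norm. -/
open MeasureTheory Metric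

/-- Young's inequality in homogeneous form. -/
lemma mul_rpow_sub_one_mul_le {p X Y : ℝ} (hp : 1 < p) (hX : 0 ≤ X) (hY : 0 ≤ Y) :
    p * (X ^ (p - 1) * Y) ≤ (p - 1) * X ^ p + Y ^ p := by
  have hp0 : 0 < p := by linarith
  have h := Real.geom_mean_le_arith_mean2_weighted (w₁ := (p - 1) / p) (w₂ := 1 / p)
    (div_nonneg (by linarith) hp0.le) (by positivity)
    (Real.rpow_nonneg hX p) (Real.rpow_nonneg hY p) (by field_simp; ring)
  rw [← Real.rpow_mul hX, ← Real.rpow_mul hY, mul_div_cancel₀ _ hp0.ne',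
    mul_div_cancel₀ _ hp0.ne', Real.rpow_one] at h
  calc p * (X ^ (p - 1) * Y) ≤ p * ((p - 1) / p * X ^ p + 1 / p * Y ^ p) := by gcongr
    _ = _ := by field_simp

/-- The divergence of the vector field `h x • x` has integral zero. -/
lemma integral_nsmul_add_fderiv_apply_self {n : ℕ} {h : EuclideanSpace ℝ (Fin n) → ℝ}
    (hh : ContDiff ℝ 1 h) (hc : HasCompactSupport h) :
    Integrable (fun x => n * h x + fderiv ℝ h x x) ∧ ∫ x, (n * h x + fderiv ℝ h x x) = 0 := by
  have hcont : Continuous (fderiv ℝ h) := hh.continuous_fderiv one_ne_zero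
  have hcoord (i : Fin n) : Continuous fun x : EuclideanSpace ℝ (Fin n) => x i := by fun_prop
  have hint : Integrable h := hh.continuous.integrable_of_hasCompactSupport hc
  have hpart (i : Fin n) :
      Integrable fun x => x i * fderiv ℝ h x (EuclideanSpace.single i (1 : ℝ)) := by
    refine Continuous.integrable_of_hasCompactSupport (by fun_prop) ?_
    exact (hc.fderiv_apply (𝕜 := ℝ) (EuclideanSpace.single i (1 : ℝ))).mul_left
  have hfd (i : Fin n) (x : EuclideanSpace ℝ (Fin n)) :
      fderiv ℝ (fun y : EuclideanSpace ℝ (Fin n) => y i) x (EuclideanSpace.single i (1 : ℝ))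
        = 1 := by
    rw [show (fun y : EuclideanSpace ℝ (Fin n) => y i) = EuclideanSpace.proj (𝕜 := ℝ) i from rfl,
      ContinuousLinearMap.fderiv]
    simp
  have hparts (i : Fin n) :
      ∫ x, x i * fderiv ℝ h x (EuclideanSpace.single i (1 : ℝ)) = -∫ x, h x := by
    rw [integral_mul_fderiv_eq_neg_fderiv_mul_of_integrable]
    · simp [hfd]
    · simpa [hfd] using hint
    · exact hpart i
    · exact ((hcoord i).mul hh.continuous).integrable_of_hasCompactSupport hc.mul_left
    · intro x _; fun_prop
    · intro x _; exact hh.differentiable one_ne_zero x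
  have hsum (x : EuclideanSpace ℝ (Fin n)) :
      fderiv ℝ h x x = ∑ i, x i * fderiv ℝ h x (EuclideanSpace.single i (1 : ℝ)) := by
    have hx := congrArg (fderiv ℝ h x) ((EuclideanSpace.basisFun (Fin n) ℝ).sum_repr x)
    simpa only [map_sum, map_smul, smul_eq_mul, EuclideanSpace.basisFun_repr,
      EuclideanSpace.basisFun_apply] using hx.symm
  have hint' : Integrable fun x => fderiv ℝ h x x := by
    simp_rw [hsum]
    exact integrable_finsetSum _ fun i _ => hpart i
  refine ⟨(hint.const_mul _).add hint', ?_⟩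
  rw [integral_add (hint.const_mul _) hint', integral_const_mul]
  simp_rw [hsum]
  rw [integral_finsetSum _ fun i _ => hpart i]
  simp [hparts]

/-- Multiplying a continuous compactly supported function by a weight that is continuous on a
neighbourhood of the support gives an integrable function. -/
lemma integrable_mul_of_tsupport {E : Type*} [TopologicalSpace E] [MeasurableSpace E]
    [OpensMeasurableSpace E] {μ : Measure E} [IsFiniteMeasureOnCompacts μ] {u w : E → ℝ}
    (hu : Continuous u) (hc : HasCompactSupport u) (hw : ∀ x ∈ tsupport u, ContinuousAt w x) :
    Integrable (fun x => u x * w x) μ := by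
  refine Continuous.integrable_of_hasCompactSupport ?_ hc.mul_right
  exact continuous_of_tsupport fun x hx =>
    hu.continuousAt.mul (hw x (tsupport_mul_subset_left hx))

lemma one_sub_div_rpow_pos {r R c : ℝ} (hr : 0 ≤ r) (hrR : r < R) (hc : 0 < c) :
    0 < 1 - (r / R) ^ c := by
  have hR : 0 < R := hr.trans_lt hrR
  linarith [Real.rpow_lt_one (div_nonneg hr hR.le) ((div_lt_one hR).2 hrR) hc]

lemma rpow_neg_mul_rpow_one_sub {a b r s : ℝ} (hr : 0 < r) (hs : 0 < s) :
    r ^ (-a) * s ^ (1 - b) = (r ^ a * s ^ b)⁻¹ * s := by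
  rw [Real.rpow_neg hr.le, Real.rpow_sub hs, Real.rpow_one, mul_inv]
  ring

lemma contDiffAt_norm_rpow_mul_one_sub_rpow {E : Type*} [NormedAddCommGroup E]
    [InnerProductSpace ℝ E] {R c : ℝ} (hc : 0 < c) (α β : ℝ) {x : E}
    (hx : x ∈ ball (0 : E) R \ {0}) :
    ContDiffAt ℝ 1 (fun y : E => ‖y‖ ^ α * (1 - (‖y‖ / R) ^ c) ^ β) x := by
  have hx0 : x ≠ 0 := hx.2
  have hxR : ‖x‖ < R := by simpa using hx.1
  have hr : 0 < ‖x‖ := norm_pos_iff.2 hx0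
  have hn : ContDiffAt ℝ 1 (fun y : E => ‖y‖) x := contDiffAt_norm ℝ hx0
  have hq : ‖x‖ / R ≠ 0 := (div_pos hr (hr.trans hxR)).ne'
  exact (hn.rpow_const_of_ne hr.ne').mul
    ((contDiffAt_const.sub ((hn.div_const R).rpow_const_of_ne hq)).rpow_const_of_ne
      (one_sub_div_rpow_pos hr.le hxR hc).ne')

/-- The Euler derivative `r * (d/dr)` of the weight `r ^ (-a) * (1 - (r/R)^c) ^ (1-b)`. -/
lemma hasDerivAt_hardyWeight {R a b c r : ℝ} (hr : 0 < r) (hrR : r < R) (hc : 0 < c) :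
    HasDerivAt (fun σ : ℝ => (σ * r) ^ (-a) * (1 - (σ * r / R) ^ c) ^ (1 - b))
      ((r ^ a * (1 - (r / R) ^ c) ^ b)⁻¹ *
        (-a * (1 - (r / R) ^ c) + (b - 1) * c * (r / R) ^ c)) 1 := by
  have hR : 0 < R := hr.trans hrR
  have hs := one_sub_div_rpow_pos hr.le hrR hc
  have hq : 0 < r / R := div_pos hr hR
  have h1 : HasDerivAt (fun σ : ℝ => σ * r) r 1 := by
    simpa using (hasDerivAt_id (1 : ℝ)).mul_const r
  have h2 := h1.rpow_const (p := -a) (Or.inl (by simpa using hr.ne'))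
  have h3 := (((h1.div_const R).rpow_const (p := c) (Or.inl (by simpa using hq.ne'))).const_sub
    1).rpow_const (p := 1 - b) (Or.inl (by simpa using hs.ne'))
  refine (h2.mul h3).congr_deriv ?_
  simp only [one_mul]
  have e1 : r ^ (-a - 1) = (r ^ a)⁻¹ / r := by rw [Real.rpow_sub_one hr.ne', Real.rpow_neg hr.le]
  have e2 : (r / R) ^ (c - 1) = (r / R) ^ c / (r / R) := Real.rpow_sub_one hq.ne' c
  have hra : 0 < r ^ a := Real.rpow_pos_of_pos hr a
  rw [e1, e2, Real.rpow_neg hr.le]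
  generalize (r / R) ^ c = t at *
  have hsb : 0 < (1 - t) ^ b := Real.rpow_pos_of_pos hs b
  have e3 : (1 - t) ^ (1 - b) = (1 - t) / (1 - t) ^ b := by rw [Real.rpow_sub hs, Real.rpow_one]
  have e4 : (1 - t) ^ (1 - b - 1) = 1 / (1 - t) ^ b := by
    rw [Real.rpow_sub_one hs.ne', e3]; field_simp
  rw [e3, e4]
  field_simp
  ring

/-- The derivative at `x` in the direction `x` of `|f| ^ p` times the radial Hardy weight. -/
lemma fderiv_abs_rpow_mul_hardyWeight_apply_self {E : Type*} [NormedAddCommGroup E]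
    [InnerProductSpace ℝ E] {R a b c p : ℝ} (hc : 0 < c) (hp : 1 < p) {f : E → ℝ} {x : E}
    (hf : DifferentiableAt ℝ f x) (hx : x ∈ ball (0 : E) R \ {0}) :
    fderiv ℝ (fun y => |f y| ^ p * (‖y‖ ^ (-a) * (1 - (‖y‖ / R) ^ c) ^ (1 - b))) x x =
      (‖x‖ ^ a * (1 - (‖x‖ / R) ^ c) ^ b)⁻¹ *
        (p * |f x| ^ (p - 2) * f x * fderiv ℝ f x x * (1 - (‖x‖ / R) ^ c) +
          |f x| ^ p * (-a * (1 - (‖x‖ / R) ^ c) + (b - 1) * c * (‖x‖ / R) ^ c)) := by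
  have hx0 : x ≠ 0 := hx.2
  have hxR : ‖x‖ < R := by simpa using hx.1
  have hr : 0 < ‖x‖ := norm_pos_iff.2 hx0
  have hs := one_sub_div_rpow_pos hr.le hxR hc
  have hline : HasDerivAt (fun σ : ℝ => σ • x) x 1 := by
    simpa using (hasDerivAt_id (1 : ℝ)).smul_const x
  have hw := ((contDiffAt_norm_rpow_mul_one_sub_rpow hc (-a) (1 - b) hx).differentiableAt
    one_ne_zero)
  have hA : HasFDerivAt (fun y => |f y| ^ p)
      ((p * |f x| ^ (p - 2) * f x) • fderiv ℝ f x) x :=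
    (hasDerivAt_abs_rpow (f x) hp).comp_hasFDerivAt x hf.hasFDerivAt
  have hB : fderiv ℝ (fun y : E => ‖y‖ ^ (-a) * (1 - (‖y‖ / R) ^ c) ^ (1 - b)) x x =
      (‖x‖ ^ a * (1 - (‖x‖ / R) ^ c) ^ b)⁻¹ *
        (-a * (1 - (‖x‖ / R) ^ c) + (b - 1) * c * (‖x‖ / R) ^ c) := by
    have h1 := HasFDerivAt.comp_hasDerivAt_of_eq (1 : ℝ) hw.hasFDerivAt hline (one_smul ℝ x).symm
    refine h1.unique ((hasDerivAt_hardyWeight hr hxR hc).congr_of_eventuallyEq ?_)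
    filter_upwards [lt_mem_nhds (zero_lt_one' ℝ)] with σ hσ
    simp [norm_smul, abs_of_pos hσ]
  rw [fderiv_fun_mul hA.differentiableAt hw, hA.fderiv]
  simp only [add_apply, smul_apply, smul_eq_mul, hB,
    rpow_neg_mul_rpow_one_sub hr hs]
  ring

/-- The pointwise inequality behind the Hardy inequality: `F` is the value of the function, `D` its
derivative in the radial direction and `N` the norm of its gradient. -/
lemma hardy_pointwise {n p a b c r s W F D N : ℝ} (hp : 1 < p) (hb : 1 < b) (hc0 : 0 < c)
    (hc : (b - 1) * c ≤ n - a) (hr : 0 ≤ r) (hs : 0 ≤ s) (hW : 0 ≤ W) (hN : 0 ≤ N)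
    (hD : |D| ≤ N * r) :
    ((b - 1) * c / p) ^ p * (|F| ^ p * W) ≤ N ^ p * (W * (r * s) ^ p) +
      ((b - 1) * c / p) ^ (p - 1) * (n * (|F| ^ p * (W * s)) +
        W * (p * |F| ^ (p - 2) * F * D * s + |F| ^ p * (-a * s + (b - 1) * c * (1 - s)))) := by
  have hl : 0 < (b - 1) * c / p := by have := sub_pos.2 hb; positivity
  have hcl : (b - 1) * c = p * ((b - 1) * c / p) := by field_simp
  generalize (b - 1) * c / p = l at *
  rw [hcl] at hc ⊢
  have hlp : l ^ p = l ^ (p - 1) * l := by rw [← Real.rpow_add_one hl.ne']; ring_nf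
  have hFp : |F| ^ (p - 2) * |F| = |F| ^ (p - 1) := by
    rcases eq_or_ne F 0 with rfl | hF
    · simp [Real.zero_rpow (by linarith : p - 1 ≠ 0)]
    · rw [← Real.rpow_add_one (abs_ne_zero.2 hF)]; ring_nf
  have hFD : -(|F| ^ (p - 1) * (N * r)) ≤ |F| ^ (p - 2) * F * D := by
    refine (neg_le_neg ?_).trans (neg_abs_le _)
    rw [abs_mul, abs_mul, abs_of_nonneg (Real.rpow_nonneg (abs_nonneg F) _), hFp]
    gcongr
  have hY := mul_rpow_sub_one_mul_le hp (mul_nonneg hl.le (abs_nonneg F))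
    (mul_nonneg hN (mul_nonneg hr hs))
  rw [Real.mul_rpow hl.le (abs_nonneg F), Real.mul_rpow hl.le (abs_nonneg F),
    Real.mul_rpow hN (mul_nonneg hr hs)] at hY
  have hFpn : 0 ≤ |F| ^ p := Real.rpow_nonneg (abs_nonneg F) _
  have hlpn : 0 ≤ l ^ (p - 1) := Real.rpow_nonneg hl.le _
  have k1 := mul_le_mul_of_nonneg_left hY hW
  have k2 := mul_le_mul_of_nonneg_left hFD (by positivity : 0 ≤ W * l ^ (p - 1) * p * s)
  have k3 := mul_le_mul_of_nonneg_left hc (by positivity : 0 ≤ W * l ^ (p - 1) * |F| ^ p * s)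
  rw [hlp] at k1 ⊢
  linarith

theorem unified_hardy_inequality_gradient {n : ℕ} (hn : 1 ≤ n) {R : ℝ} (hR : 0 < R)
    {p b a c : ℝ} (hp : 1 < p) (hb : 1 < b) (ha : a < (n : ℝ))
    (hc0 : 0 < c) (hc : c ≤ ((n : ℝ) - a) / (b - 1))
    (f : EuclideanSpace ℝ (Fin n) → ℝ)
    (hf : ContDiff ℝ 1 f) (hcomp : HasCompactSupport f)
    (hsupp : tsupport f ⊆ ball (0 : EuclideanSpace ℝ (Fin n)) R \ {0}) :
    ((b - 1) * c / p) ^ p *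
      ∫ x in ball (0 : EuclideanSpace ℝ (Fin n)) R,
        |f x| ^ p / (‖x‖ ^ a * (1 - (‖x‖ / R) ^ c) ^ b) ≤
    ∫ x in ball (0 : EuclideanSpace ℝ (Fin n)) R,
        ‖gradient f x‖ ^ p / (‖x‖ ^ (a - p) * (1 - (‖x‖ / R) ^ c) ^ (b - p)) := by
  have hp0 : 0 < p := by linarith
  have hgrad (x) : ‖gradient f x‖ = ‖fderiv ℝ f x‖ := by
    rw [← toDual_gradient, LinearIsometryEquiv.norm_map]
  simp only [hgrad, div_eq_mul_inv _ (_ * _ : ℝ)]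
  have hw (α β : ℝ) : ∀ x ∈ tsupport f,
      ContDiffAt ℝ 1 (fun y : EuclideanSpace ℝ (Fin n) => ‖y‖ ^ α * (1 - (‖y‖ / R) ^ c) ^ β) x :=
    fun x hx => contDiffAt_norm_rpow_mul_one_sub_rpow hc0 α β (hsupp hx)
  have hwinv (α β : ℝ) : ∀ x ∈ tsupport f, ContinuousAt
      (fun y : EuclideanSpace ℝ (Fin n) => (‖y‖ ^ α * (1 - (‖y‖ / R) ^ c) ^ β)⁻¹) x := by
    intro x hx
    have hxR : ‖x‖ < R := by simpa using (hsupp hx).1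
    have hr : 0 < ‖x‖ := norm_pos_iff.2 (hsupp hx).2
    have hs := one_sub_div_rpow_pos hr.le hxR hc0
    exact (hw α β x hx).continuousAt.inv₀ (by positivity)
  have hsub_rpow : tsupport (fun x => |f x| ^ p) ⊆ tsupport f :=
    tsupport_comp_subset (g := fun t : ℝ => |t| ^ p) (by simp [Real.zero_rpow hp0.ne']) f
  have hsub_fderiv : tsupport (fun x => ‖fderiv ℝ f x‖ ^ p) ⊆ tsupport f :=
    (tsupport_comp_subset (g := fun L : EuclideanSpace ℝ (Fin n) →L[ℝ] ℝ => ‖L‖ ^ p)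
      (by simp [Real.zero_rpow hp0.ne']) _).trans (tsupport_fderiv_subset ℝ)
  have hfp : ContDiff ℝ 1 (fun x => |f x| ^ p) := hf.norm_rpow hp
  have hfp_comp : HasCompactSupport (fun x => |f x| ^ p) :=
    hcomp.of_isClosed_subset (isClosed_tsupport _) hsub_rpow
  have hdf : Continuous (fun x => ‖fderiv ℝ f x‖ ^ p) :=
    (hf.continuous_fderiv one_ne_zero).norm.rpow_const fun _ => Or.inr hp0.le
  have hI1 := integrable_mul_of_tsupport (μ := volume) hfp.continuous hfp_comp
    fun x hx => hwinv a b x (hsub_rpow hx)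
  have hI2 := integrable_mul_of_tsupport (μ := volume) hdf
    (hcomp.of_isClosed_subset (isClosed_tsupport _) hsub_fderiv)
    fun x hx => hwinv (a - p) (b - p) x (hsub_fderiv hx)
  set h : EuclideanSpace ℝ (Fin n) → ℝ :=
    fun y => |f y| ^ p * (‖y‖ ^ (-a) * (1 - (‖y‖ / R) ^ c) ^ (1 - b)) with hh
  have hh_sub : tsupport h ⊆ tsupport f := tsupport_mul_subset_left.trans hsub_rpow
  have hh_diff : ContDiff ℝ 1 h := contDiff_iff_contDiffAt.2 fun x => by
    by_cases hx : x ∈ tsupport h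
    · exact hfp.contDiffAt.mul (hw _ _ x (hh_sub hx))
    · exact contDiffAt_const.congr_of_eventuallyEq (notMem_tsupport_iff_eventuallyEq.1 hx)
  obtain ⟨hI3, hzero⟩ := integral_nsmul_add_fderiv_apply_self hh_diff hfp_comp.mul_right
  have hset : ∫ x in ball (0 : EuclideanSpace ℝ (Fin n)) R, (n * h x + fderiv ℝ h x x) = 0 := by
    rw [setIntegral_eq_integral_of_forall_compl_eq_zero, hzero]
    intro x hx
    have hxf : x ∉ tsupport h := fun hx' => hx (hsupp (hh_sub hx')).1
    rw [image_eq_zero_of_notMem_tsupport hxf,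
      image_eq_zero_of_notMem_tsupport fun h' => hxf (tsupport_fderiv_subset ℝ h')]
    simp
  rw [← integral_const_mul]
  calc _ ≤ ∫ x in ball (0 : EuclideanSpace ℝ (Fin n)) R,
        (‖fderiv ℝ f x‖ ^ p * (‖x‖ ^ (a - p) * (1 - (‖x‖ / R) ^ c) ^ (b - p))⁻¹ +
          ((b - 1) * c / p) ^ (p - 1) * (n * h x + fderiv ℝ h x x)) := by
        refine setIntegral_mono_on (hI1.const_mul _).integrableOn
          (hI2.add (hI3.const_mul _)).integrableOn measurableSet_ball fun x hx => ?_
        have hxR : ‖x‖ < R := by simpa using hx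
        have hs := one_sub_div_rpow_pos (norm_nonneg x) hxR hc0
        rcases eq_or_ne x 0 with rfl | hx0
        · have hf0 : f 0 = 0 := image_eq_zero_of_notMem_tsupport fun h' => (hsupp h').2 rfl
          have hh0 : h 0 = 0 := by simp [hh, hf0, Real.zero_rpow hp0.ne']
          simp only [hf0, hh0, abs_zero, Real.zero_rpow hp0.ne', map_zero, mul_zero, zero_mul,
            add_zero]
          positivity
        have hr : 0 < ‖x‖ := norm_pos_iff.2 hx0
        rw [hh, fderiv_abs_rpow_mul_hardyWeight_apply_self hc0 hp
          (hf.differentiable one_ne_zero x) ⟨hx, hx0⟩]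
        have key := hardy_pointwise (n := n) (a := a) (F := f x) (s := 1 - (‖x‖ / R) ^ c)
          (W := (‖x‖ ^ a * (1 - (‖x‖ / R) ^ c) ^ b)⁻¹) hp hb hc0
          (by rw [le_div_iff₀ (sub_pos.2 hb)] at hc; linarith) hr.le hs.le (by positivity)
          (norm_nonneg _) ((fderiv ℝ f x).le_opNorm x)
        have e1 : (‖x‖ ^ (a - p) * (1 - (‖x‖ / R) ^ c) ^ (b - p))⁻¹ =
            (‖x‖ ^ a * (1 - (‖x‖ / R) ^ c) ^ b)⁻¹ * (‖x‖ * (1 - (‖x‖ / R) ^ c)) ^ p := by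
          rw [Real.rpow_sub hr, Real.rpow_sub hs, Real.mul_rpow hr.le hs.le]
          field_simp
        rw [sub_sub_cancel] at key
        simp only [e1, rpow_neg_mul_rpow_one_sub hr hs]
        exact key
    _ = _ := by
        rw [integral_add hI2.integrableOn (hI3.const_mul _).integrableOn, integral_const_mul,
          hset, mul_zero, add_zero]
end

section
/- Let n ≥ 1, R > 0, 1 < p < ∞, b > 1, a < n and 0 < c ≤ (n-a)/(b-1). Then the constant ((b-1)c/p)^p in the unified Hardy inequality is sharp and is not attained. Precisely: (i) for every ε > 0 there exists a nonzero f ∈ C_0^1(B(0,R)\{0}) such that ∫_{B(0,R)} |𝓡f(x)|^p / (|x|^{a-p} (1-(|x|/R)^c)^{b-p}) dx is finite and strictly less than (((b-1)c/p)^p + ε) · ∫_{B(0,R)} |f(x)|^p / (|x|^a (1-(|x|/R)^c)^b) dx; and (ii) for every f ∈ C_0^1(B(0,R)\{0}) with f not identically zero for which ∫_{B(0,R)} |𝓡f(x)|^p / (|x|^{a-p} (1-(|x|/R)^c)^{b-p}) dx is finite, the strict inequality ((b-1)c/p)^p · ∫_{B(0,R)} |f(x)|^p / (|x|^a (1-(|x|/R)^c)^b)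 dx < ∫_{B(0,R)} |𝓡f(x)|^p / (|x|^{a-p} (1-(|x|/R)^c)^{b-p}) dx holds. -/
open MeasureTheory Metric

/-- The radial derivative `𝓡f(x) = Df(x)[x/|x|]` of a complex-valued function on `ℝⁿ`. -/
noncomputable def radDeriv {n : ℕ} (f : EuclideanSpace ℝ (Fin n) → ℂ)
    (x : EuclideanSpace ℝ (Fin n)) : ℂ :=
  fderiv ℝ f x (‖x‖⁻¹ • x)

/-- The integral of the divergence of `x ↦ G x • x` vanishes. -/
theorem integral_dim_mul_add_fderiv_self {n : ℕ} {G : EuclideanSpace ℝ (Fin n) → ℝ}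
    (hG : ContDiff ℝ 1 G) (hGs : HasCompactSupport G) :
    ∫ x, ((n : ℝ) * G x + fderiv ℝ G x x) = 0 := by
  have hGc : Continuous G := hG.continuous
  have hdc : Continuous (fderiv ℝ G) := hG.continuous_fderiv one_ne_zero
  have hcoord (i : Fin n) : Integrable
      (fun x => G x + (EuclideanSpace.proj i : EuclideanSpace ℝ (Fin n) →L[ℝ] ℝ) x *
        fderiv ℝ G x (EuclideanSpace.single i 1)) ∧
      ∫ x, (G x + (EuclideanSpace.proj i : EuclideanSpace ℝ (Fin n) →L[ℝ] ℝ) x *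
        fderiv ℝ G x (EuclideanSpace.single i 1)) = 0 := by
    set L : EuclideanSpace ℝ (Fin n) →L[ℝ] ℝ := EuclideanSpace.proj i with hL
    have hL1 : L (EuclideanSpace.single i 1) = 1 := by simp [hL]
    have hi1 : Integrable G := hGc.integrable_of_hasCompactSupport hGs
    have hds : HasCompactSupport (fun x => fderiv ℝ G x (EuclideanSpace.single i 1)) :=
      hGs.fderiv_apply ℝ _
    have hi2 : Integrable (fun x => L x * fderiv ℝ G x (EuclideanSpace.single i 1)) :=
      Continuous.integrable_of_hasCompactSupport (by fun_prop) hds.mul_left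
    have hi3 : Integrable (fun x => L x * G x) :=
      Continuous.integrable_of_hasCompactSupport (by fun_prop) hGs.mul_left
    have key := integral_mul_fderiv_eq_neg_fderiv_mul_of_integrable (μ := volume)
      (f := L) (g := G) (v := EuclideanSpace.single i 1) (by simpa [hL1] using hi1) hi2 hi3
      (fun x _ => L.differentiableAt) (fun x _ => hG.differentiable one_ne_zero x)
    refine ⟨hi1.add hi2, ?_⟩
    rw [integral_add hi1 hi2, key]
    simp [hL1]
  have hsum : ∀ x, (n : ℝ) * G x + fderiv ℝ G x x = ∑ i : Fin n,
      (G x + (EuclideanSpace.proj i : EuclideanSpace ℝ (Fin n) →L[ℝ] ℝ) x *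
        fderiv ℝ G x (EuclideanSpace.single i 1)) := by
    intro x
    have hx : x = ∑ i : Fin n, x i • EuclideanSpace.single i (1 : ℝ) := by
      simpa using ((EuclideanSpace.basisFun (Fin n) ℝ).sum_repr x).symm
    rw [Finset.sum_add_distrib]
    conv_lhs => rw [show fderiv ℝ G x x = fderiv ℝ G x
      (∑ i : Fin n, x i • EuclideanSpace.single i (1 : ℝ)) by rw [← hx]]
    simp [map_sum]
  simp_rw [hsum]
  rw [integral_finsetSum _ fun i _ => (hcoord i).1]
  exact Finset.sum_eq_zero fun i _ => (hcoord i).2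

theorem mul_rpow_sub_one_mul_le_s4 {p A B : ℝ} (hp : 1 < p) (hA : 0 ≤ A) (hB : 0 ≤ B) :
    p * (A ^ (p - 1) * B) ≤ B ^ p + (p - 1) * A ^ p := by
  have hpq := Real.HolderConjugate.conjExponent hp
  have h := Real.young_inequality_of_nonneg hB (Real.rpow_nonneg hA (p - 1)) hpq
  rw [← Real.rpow_mul hA] at h
  have h1 : (p - 1) * p.conjExponent = p := hpq.sub_one_mul_conj
  have h2 : p * (A ^ p / p.conjExponent) = (p - 1) * A ^ p := by
    rw [← hpq.div_conj_eq_sub_one]; ring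
  rw [h1] at h
  have h3 : p * (B ^ p / p) = B ^ p := by field_simp
  nlinarith

theorem radial_weight_eq {p a b r t y : ℝ} (hr : 0 < r) (ht : 0 < t) (hy : 0 ≤ y) :
    y ^ p / (r ^ (a - p) * t ^ (b - p)) = r ^ (-a) * t ^ (-b) * (t * (r * y)) ^ p := by
  rw [Real.mul_rpow ht.le (by positivity), Real.mul_rpow hr.le hy, Real.rpow_sub hr,
    Real.rpow_sub ht, Real.rpow_neg hr.le, Real.rpow_neg ht.le]
  have := Real.rpow_pos_of_pos hr p
  have := Real.rpow_pos_of_pos ht p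
  have := Real.rpow_pos_of_pos hr a
  have := Real.rpow_pos_of_pos ht b
  field_simp

theorem div_weight_eq {a b r t y : ℝ} (hr : 0 < r) (ht : 0 < t) :
    y / (r ^ a * t ^ b) = r ^ (-a) * t ^ (-b) * y := by
  rw [Real.rpow_neg hr.le, Real.rpow_neg ht.le]
  field_simp

theorem div_rpow_lt_one {R c r : ℝ} (hR : 0 < R) (hc : 0 < c) (hr : 0 ≤ r) (hrR : r < R) :
    (r / R) ^ c < 1 :=
  Real.rpow_lt_one (by positivity) ((div_lt_one hR).2 hrR) hc

theorem hasDerivAt_div_rpow {R r : ℝ} (c : ℝ) (hR : 0 < R) (hr : 0 < r) :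
    HasDerivAt (fun r => (r / R) ^ c) (c * (r / R) ^ c / r) r := by
  have h := ((hasDerivAt_id r).div_const R).rpow_const (p := c)
    (Or.inl (by simp; constructor <;> positivity))
  refine h.congr_deriv ?_
  rw [Real.rpow_sub_one (by simp; constructor <;> positivity)]
  simp only [id]
  field_simp

/-- The derivative of a radial function in the direction of the position vector. -/
theorem HasDerivAt.hasFDerivAt_comp_norm {n : ℕ} {F : Type*} [NormedAddCommGroup F]
    [NormedSpace ℝ F] {v : ℝ → F} {v' : F}
    {x : EuclideanSpace ℝ (Fin n)} (hx : x ≠ 0) (h : HasDerivAt v v' ‖x‖) :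
    DifferentiableAt ℝ (fun y : EuclideanSpace ℝ (Fin n) => v ‖y‖) x ∧
      fderiv ℝ (fun y : EuclideanSpace ℝ (Fin n) => v ‖y‖) x x = ‖x‖ • v' := by
  have hn : DifferentiableAt ℝ (fun y : EuclideanSpace ℝ (Fin n) => ‖y‖) x :=
    (contDiffAt_norm ℝ hx (n := 1)).differentiableAt one_ne_zero
  have h2 := h.hasFDerivAt.comp x hn.hasFDerivAt
  refine ⟨h2.differentiableAt, ?_⟩
  have h3 := h2.fderiv
  simp only [Function.comp_def] at h3
  rw [h3]
  simp [hn.fderiv_norm_self]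

theorem continuous_hasCompactSupport_of_continuousOn {X : Type*} [TopologicalSpace X]
    [T2Space X] {q : X → ℝ} {K U : Set X}
    (hK : IsCompact K) (hU : IsOpen U) (hKU : K ⊆ U) (hq : ContinuousOn q U)
    (h0 : ∀ x ∉ K, q x = 0) : Continuous q ∧ HasCompactSupport q := by
  have hs : tsupport q ⊆ K := closure_minimal
    (fun x hx => by_contra fun h => hx (h0 x h)) hK.isClosed
  exact ⟨continuous_of_tsupport fun x hx => hq.continuousAt (hU.mem_nhds (hKU (hs hx))),
    HasCompactSupport.intro hK h0⟩

theorem continuousOn_radial_weight {n : ℕ} {R c : ℝ} (hR : 0 < R) (hc : 0 < c) (α β : ℝ) :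
    ContinuousOn (fun x : EuclideanSpace ℝ (Fin n) => ‖x‖ ^ α * (1 - (‖x‖ / R) ^ c) ^ β)
      (ball 0 R \ {0}) := by
  intro x hx
  have hx0 : 0 < ‖x‖ := norm_pos_iff.2 hx.2
  have hs : (‖x‖ / R) ^ c < 1 := div_rpow_lt_one hR hc hx0.le (by simpa using hx.1)
  have h1 : ContinuousAt (fun x : EuclideanSpace ℝ (Fin n) => (‖x‖ / R) ^ c) x :=
    (continuous_norm.continuousAt.div_const R).rpow_const (Or.inr hc.le)
  exact ((continuous_norm.continuousAt.rpow_const (Or.inl hx0.ne')).mul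
    ((h1.const_sub 1).rpow_const (Or.inl (sub_pos.2 hs).ne'))).continuousWithinAt

theorem continuousOn_div_radial_weight {n : ℕ} {R c : ℝ} (hR : 0 < R) (hc : 0 < c) (α β : ℝ)
    {g : EuclideanSpace ℝ (Fin n) → ℝ} (hg : ContinuousOn g (ball 0 R \ {0})) :
    ContinuousOn (fun x => g x / (‖x‖ ^ α * (1 - (‖x‖ / R) ^ c) ^ β)) (ball 0 R \ {0}) := by
  refine hg.div (continuousOn_radial_weight hR hc α β) fun x hx => ?_
  have hx0 : 0 < ‖x‖ := norm_pos_iff.2 hx.2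
  have hs : (‖x‖ / R) ^ c < 1 := div_rpow_lt_one hR hc hx0.le (by simpa using hx.1)
  have := sub_pos.2 hs
  positivity

theorem radDeriv_eq_zero_of_notMem_tsupport {n : ℕ} {f : EuclideanSpace ℝ (Fin n) → ℂ}
    {x : EuclideanSpace ℝ (Fin n)} (hx : x ∉ tsupport f) : radDeriv f x = 0 := by
  rw [radDeriv, fderiv_of_notMem_tsupport ℝ hx]
  simp

theorem continuous_hardy_numerator {n : ℕ} {R p b a c : ℝ} (hR : 0 < R) (hp : 0 < p) (hc : 0 < c)
    {f : EuclideanSpace ℝ (Fin n) → ℂ} (hf : ContDiff ℝ 1 f) (hfs : HasCompactSupport f)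
    (hft : tsupport f ⊆ ball 0 R \ {0}) :
    Continuous (fun x =>
        ‖radDeriv f x‖ ^ p / (‖x‖ ^ (a - p) * (1 - (‖x‖ / R) ^ c) ^ (b - p))) ∧
      HasCompactSupport (fun x =>
        ‖radDeriv f x‖ ^ p / (‖x‖ ^ (a - p) * (1 - (‖x‖ / R) ^ c) ^ (b - p))) := by
  refine continuous_hasCompactSupport_of_continuousOn hfs
    (isOpen_ball.sdiff isClosed_singleton) hft ?_ ?_
  · refine continuousOn_div_radial_weight hR hc _ _ ?_
    refine ContinuousOn.rpow_const ?_ fun _ _ => Or.inr hp.le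
    refine ContinuousOn.norm ?_
    refine (hf.continuous_fderiv one_ne_zero).continuousOn.clm_apply ?_
    exact (continuous_norm.continuousOn.inv₀ fun x hx => norm_ne_zero_iff.2 hx.2).smul
      continuousOn_id
  · intro x hx
    simp [radDeriv_eq_zero_of_notMem_tsupport hx, Real.zero_rpow hp.ne']

theorem continuous_hardy_denominator {n : ℕ} {R p b a c : ℝ} (hR : 0 < R) (hp : 0 < p) (hc : 0 < c)
    {f : EuclideanSpace ℝ (Fin n) → ℂ} (hf : Continuous f) (hfs : HasCompactSupport f)
    (hft : tsupport f ⊆ ball 0 R \ {0}) :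
    Continuous (fun x => ‖f x‖ ^ p / (‖x‖ ^ a * (1 - (‖x‖ / R) ^ c) ^ b)) ∧
      HasCompactSupport (fun x => ‖f x‖ ^ p / (‖x‖ ^ a * (1 - (‖x‖ / R) ^ c) ^ b)) := by
  refine continuous_hasCompactSupport_of_continuousOn hfs
    (isOpen_ball.sdiff isClosed_singleton) hft ?_ ?_
  · exact continuousOn_div_radial_weight hR hc _ _
      (hf.norm.rpow_const fun _ => Or.inr hp.le).continuousOn
  · intro x hx
    simp [image_eq_zero_of_notMem_tsupport hx, Real.zero_rpow hp.ne']

theorem fderiv_self_eq_norm_mul_radDeriv {n : ℕ} (f : EuclideanSpace ℝ (Fin n) → ℂ)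
    (x : EuclideanSpace ℝ (Fin n)) : fderiv ℝ f x x = ‖x‖ * radDeriv f x := by
  rcases eq_or_ne x 0 with rfl | hx
  · simp
  · have : (‖x‖ : ℂ) ≠ 0 := by exact_mod_cast norm_ne_zero_iff.2 hx
    simp [radDeriv]
    field_simp

theorem abs_fderiv_norm_rpow_self_le {n : ℕ} {p : ℝ} (hp : 1 < p)
    {f : EuclideanSpace ℝ (Fin n) → ℂ} (hf : Differentiable ℝ f)
    (x : EuclideanSpace ℝ (Fin n)) :
    |fderiv ℝ (fun x => ‖f x‖ ^ p) x x| ≤ p * (‖f x‖ ^ (p - 1) * (‖x‖ * ‖radDeriv f x‖)) := by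
  rw [hf.fderiv_norm_rpow hp]
  have h1 : |inner ℝ (f x) (fderiv ℝ f x x)| ≤ ‖f x‖ * (‖x‖ * ‖radDeriv f x‖) := by
    refine (abs_real_inner_le_norm _ _).trans_eq ?_
    rw [fderiv_self_eq_norm_mul_radDeriv]
    simp
  have h2 : ‖f x‖ ^ (p - 2) * ‖f x‖ = ‖f x‖ ^ (p - 1) := by
    rw [← Real.rpow_add_one' (by positivity) (by linarith)]
    ring_nf
  have h3 : 0 ≤ p * ‖f x‖ ^ (p - 2) := by positivity
  calc _ = p * ‖f x‖ ^ (p - 2) * |inner ℝ (f x) (fderiv ℝ f x x)| := by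
        simp [abs_mul, abs_of_nonneg (zero_le_one.trans hp.le),
          abs_of_nonneg (Real.rpow_nonneg (norm_nonneg (f x)) (p - 2))]
    _ ≤ p * ‖f x‖ ^ (p - 2) * (‖f x‖ * (‖x‖ * ‖radDeriv f x‖)) := by gcongr
    _ = _ := by rw [← h2]; ring

/-- The pointwise inequality behind the Hardy inequality, for `r = |x|`, `s = (|x| / R) ^ c`,
`A = |f x|`, `B = |𝓡f x|` and `d` the derivative of `|f| ^ p` in the direction `x`. -/
theorem hardy_pointwise_s4 {p b a c N K r s A B d : ℝ} (hp : 1 < p) (hb : 1 < b)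
    (hc : 0 < c) (hcN : (b - 1) * c ≤ N - a) (hK : K = (b - 1) * c / p) (hr : 0 < r)
    (hs1 : s < 1) (hA : 0 ≤ A) (hB : 0 ≤ B)
    (hd : |d| ≤ p * (A ^ (p - 1) * (r * B))) :
    0 ≤ ((1 - s) * (r * B)) ^ p - K ^ p * A ^ p +
        K ^ (p - 1) * (A ^ p * ((N - a) * (1 - s) + (b - 1) * c * s) + (1 - s) * d) ∧
      (((1 - s) * (r * B)) ^ p - K ^ p * A ^ p +
        K ^ (p - 1) * (A ^ p * ((N - a) * (1 - s) + (b - 1) * c * s) + (1 - s) * d) = 0 →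
        d ≤ 0) := by
  have ht : 0 < 1 - s := sub_pos.2 hs1
  have hb' : 0 < b - 1 := sub_pos.2 hb
  have hp0 : 0 < p := by linarith
  have hK0 : 0 < K := by rw [hK]; positivity
  have hpK : (b - 1) * c = p * K := by rw [hK]; field_simp
  have hKp : K ^ p = K ^ (p - 1) * K := by
    rw [← Real.rpow_add_one hK0.ne']; ring_nf
  have hKp0 : 0 < K ^ (p - 1) := Real.rpow_pos_of_pos hK0 _
  have hAp : 0 ≤ A ^ p := Real.rpow_nonneg hA p
  have hM : 0 ≤ ((1 - s) * (r * B)) ^ p := by positivity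
  have hbr : p * K ≤ (N - a) * (1 - s) + (b - 1) * c * s := by
    rw [hpK] at hcN ⊢
    nlinarith
  have hlow : K ^ (p - 1) * (A ^ p * (p * K)) ≤
      K ^ (p - 1) * (A ^ p * ((N - a) * (1 - s) + (b - 1) * c * s)) := by gcongr
  constructor
  · have hy := mul_rpow_sub_one_mul_le_s4 hp (mul_nonneg hK0.le hA)
      (show 0 ≤ (1 - s) * (r * B) by positivity)
    rw [Real.mul_rpow hK0.le hA, Real.mul_rpow hK0.le hA] at hy
    have h1 : K ^ (p - 1) * ((1 - s) * -d) ≤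
        K ^ (p - 1) * ((1 - s) * (p * (A ^ (p - 1) * (r * B)))) := by
      gcongr
      exact (neg_le_abs d).trans hd
    rw [hKp] at hy ⊢
    linarith
  · intro h0
    by_contra! hdpos
    have h1 : 0 < K ^ (p - 1) * ((1 - s) * d) := by positivity
    have h2 : 0 ≤ (p - 1) * (K ^ (p - 1) * K * A ^ p) :=
      mul_nonneg (by linarith) (by positivity)
    rw [hKp] at h0
    linarith

theorem contDiff_of_forall_mem_tsupport {E F : Type*} [NormedAddCommGroup E] [NormedSpace ℝ E]
    [NormedAddCommGroup F] [NormedSpace ℝ F] {f : E → F}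
    (h : ∀ x ∈ tsupport f, ContDiffAt ℝ 1 f x) : ContDiff ℝ 1 f := by
  refine contDiff_iff_contDiffAt.2 fun x => ?_
  by_cases hx : x ∈ tsupport f
  · exact h x hx
  · exact contDiffAt_const.congr_of_eventuallyEq (notMem_tsupport_iff_eventuallyEq.1 hx)

theorem hasDerivAt_radial_weight {R c r : ℝ} (hR : 0 < R) (hc : 0 < c) (hr : 0 < r) (hrR : r < R)
    (a b : ℝ) :
    HasDerivAt (fun r => r ^ (-a) * (1 - (r / R) ^ c) ^ (1 - b))
      (r ^ (-a) * (1 - (r / R) ^ c) ^ (-b) *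
        (-a * (1 - (r / R) ^ c) + (b - 1) * c * (r / R) ^ c) / r) r := by
  have ht : 0 < 1 - (r / R) ^ c := sub_pos.2 (div_rpow_lt_one hR hc hr.le hrR)
  have h1 : HasDerivAt (fun r : ℝ => r ^ (-a)) (-a * r ^ (-a - 1)) r :=
    Real.hasDerivAt_rpow_const (Or.inl hr.ne')
  have h2 := ((hasDerivAt_div_rpow c hR hr).const_sub 1).rpow_const (p := 1 - b)
    (Or.inl ht.ne')
  refine (h1.mul h2).congr_deriv ?_
  rw [show 1 - b - 1 = -b by ring, Real.rpow_sub_one hr.ne',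
    show (1 - b) = -b + 1 by ring, Real.rpow_add_one ht.ne']
  field_simp
  ring

theorem contDiffAt_radial_weight {n : ℕ} {R c : ℝ} (hR : 0 < R) (hc : 0 < c) (α β : ℝ)
    {x : EuclideanSpace ℝ (Fin n)} (hx : x ∈ ball 0 R \ {0}) :
    ContDiffAt ℝ 1 (fun x : EuclideanSpace ℝ (Fin n) => ‖x‖ ^ α * (1 - (‖x‖ / R) ^ c) ^ β) x := by
  have hx0 : 0 < ‖x‖ := norm_pos_iff.2 hx.2
  have hs : (‖x‖ / R) ^ c < 1 := div_rpow_lt_one hR hc hx0.le (by simpa using hx.1)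
  have hn : ContDiffAt ℝ 1 (fun x : EuclideanSpace ℝ (Fin n) => ‖x‖) x := contDiffAt_norm ℝ hx.2
  exact (hn.rpow_const_of_ne hx0.ne').mul ((contDiffAt_const.sub
    ((hn.div_const R).rpow_const_of_ne (by positivity))).rpow_const_of_ne (sub_pos.2 hs).ne')

theorem eq_zero_of_fderiv_self_nonpos {E : Type*} [NormedAddCommGroup E] [NormedSpace ℝ E]
    {F : E → ℝ} (hF : Differentiable ℝ F) (hd : ∀ x, fderiv ℝ F x x ≤ 0) (h0 : F 0 = 0)
    (hnn : ∀ x, 0 ≤ F x) (x : E) : F x = 0 := by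
  have hder (t : ℝ) : HasDerivAt (fun t : ℝ => F (t • x)) (fderiv ℝ F (t • x) x) t := by
    exact ((hF (t • x)).hasFDerivAt.comp_hasDerivAt t
      ((hasDerivAt_id t).smul_const x)).congr_deriv (by simp)
  have hanti : AntitoneOn (fun t : ℝ => F (t • x)) (Set.Icc 0 1) := by
    refine antitoneOn_of_deriv_nonpos (convex_Icc 0 1)
      (fun t _ => (hder t).continuousAt.continuousWithinAt)
      (fun t _ => (hder t).differentiableAt.differentiableWithinAt) fun t ht => ?_
    rw [interior_Icc] at ht
    rw [(hder t).deriv]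
    have h := hd (t • x)
    rw [map_smul, smul_eq_mul] at h
    exact nonpos_of_mul_nonpos_right h ht.1
  have h := hanti (Set.left_mem_Icc.2 zero_le_one) (Set.right_mem_Icc.2 zero_le_one) zero_le_one
  simp only [one_smul, zero_smul, h0] at h
  exact le_antisymm h (hnn x)

theorem unified_hardy_strict {n : ℕ} {R : ℝ} (hR : 0 < R) {p b a c : ℝ} (hp : 1 < p) (hb : 1 < b)
    (hc0 : 0 < c) (hc : (b - 1) * c ≤ (n : ℝ) - a) {f : EuclideanSpace ℝ (Fin n) → ℂ}
    (hf : ContDiff ℝ 1 f) (hfs : HasCompactSupport f)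
    (hft : tsupport f ⊆ ball (0 : EuclideanSpace ℝ (Fin n)) R \ {0}) (hf0 : f ≠ 0) :
    ((b - 1) * c / p) ^ p *
        (∫ x in ball (0 : EuclideanSpace ℝ (Fin n)) R,
          ‖f x‖ ^ p / (‖x‖ ^ a * (1 - (‖x‖ / R) ^ c) ^ b)) <
      ∫ x in ball (0 : EuclideanSpace ℝ (Fin n)) R,
          ‖radDeriv f x‖ ^ p / (‖x‖ ^ (a - p) * (1 - (‖x‖ / R) ^ c) ^ (b - p)) := by
  have hp0 : 0 < p := by linarith
  have hout : ∀ x ∉ ball (0 : EuclideanSpace ℝ (Fin n)) R, x ∉ tsupport f :=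
    fun x hx h => hx (hft h).1
  rw [setIntegral_eq_integral_of_forall_compl_eq_zero fun x hx => by
      simp [image_eq_zero_of_notMem_tsupport (hout x hx), Real.zero_rpow hp0.ne'],
    setIntegral_eq_integral_of_forall_compl_eq_zero fun x hx => by
      simp [radDeriv_eq_zero_of_notMem_tsupport (hout x hx), Real.zero_rpow hp0.ne']]
  obtain ⟨hNc, hNs⟩ := continuous_hardy_numerator (a := a) (b := b) hR hp0 hc0 hf hfs hft
  obtain ⟨hDc, hDs⟩ := continuous_hardy_denominator (a := a) (b := b) hR hp0 hc0 hf.continuous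
    hfs hft
  set Nu : EuclideanSpace ℝ (Fin n) → ℝ := fun x =>
    ‖radDeriv f x‖ ^ p / (‖x‖ ^ (a - p) * (1 - (‖x‖ / R) ^ c) ^ (b - p)) with hNu
  set De : EuclideanSpace ℝ (Fin n) → ℝ := fun x =>
    ‖f x‖ ^ p / (‖x‖ ^ a * (1 - (‖x‖ / R) ^ c) ^ b) with hDe
  set K := (b - 1) * c / p with hK
  have hb' : 0 < b - 1 := sub_pos.2 hb
  set F : EuclideanSpace ℝ (Fin n) → ℝ := fun x => ‖f x‖ ^ p with hF
  have hFC : ContDiff ℝ 1 F := hf.norm_rpow hp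
  have hFd : Differentiable ℝ F := hFC.differentiable one_ne_zero
  have hF0 : ∀ x ∉ tsupport f, F x = 0 := fun x hx => by
    simp [hF, image_eq_zero_of_notMem_tsupport hx, Real.zero_rpow hp0.ne']
  have hFt : tsupport F ⊆ tsupport f := closure_minimal
    (fun x hx => by_contra fun h => hx (hF0 x h)) (isClosed_tsupport f)
  set v : ℝ → ℝ := fun r => r ^ (-a) * (1 - (r / R) ^ c) ^ (1 - b) with hv
  set G : EuclideanSpace ℝ (Fin n) → ℝ := fun x => F x * v ‖x‖ with hG
  have hGt : tsupport G ⊆ tsupport f := (tsupport_mul_subset_left).trans hFt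
  have hGs : HasCompactSupport G := hfs.mono' ((subset_tsupport G).trans hGt)
  have hGC : ContDiff ℝ 1 G := contDiff_of_forall_mem_tsupport fun x hx =>
    hFC.contDiffAt.mul (contDiffAt_radial_weight hR hc0 _ _ (hft (hGt hx)))
  have hdiv := integral_dim_mul_add_fderiv_self hGC hGs
  set Φ : EuclideanSpace ℝ (Fin n) → ℝ := fun x =>
    Nu x - K ^ p * De x + K ^ (p - 1) * (n * G x + fderiv ℝ G x x) with hΦ
  have hGd : Continuous fun x => fderiv ℝ G x x :=
    (hGC.continuous_fderiv one_ne_zero).clm_apply continuous_id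
  have hGds : HasCompactSupport fun x => fderiv ℝ G x x :=
    HasCompactSupport.intro hGs fun x hx => by simp [fderiv_of_notMem_tsupport ℝ hx]
  have hNi := hNc.integrable_of_hasCompactSupport (μ := volume) hNs
  have hDi := hDc.integrable_of_hasCompactSupport (μ := volume) hDs
  have hGi := (hGC.continuous.integrable_of_hasCompactSupport (μ := volume) hGs).const_mul (n : ℝ)
    |>.add (hGd.integrable_of_hasCompactSupport (μ := volume) hGds)
  have hΦi : Integrable Φ := (hNi.sub (hDi.const_mul _)).add (hGi.const_mul _)
  have hΦint : ∫ x, Φ x = (∫ x, Nu x) - K ^ p * ∫ x, De x := by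
    have h1 := integral_add (hNi.sub (hDi.const_mul (K ^ p))) (hGi.const_mul (K ^ (p - 1)))
    simp only [Pi.sub_apply, Pi.add_apply] at h1
    rw [h1, integral_sub hNi (hDi.const_mul _), integral_const_mul, integral_const_mul, hdiv]
    ring
  have hΦc : Continuous Φ :=
    (hNc.sub (continuous_const.mul hDc)).add
      (continuous_const.mul ((continuous_const.mul hGC.continuous).add hGd))
  have hpt : ∀ x ∈ ball (0 : EuclideanSpace ℝ (Fin n)) R \ {0},
      0 ≤ Φ x ∧ (Φ x = 0 → fderiv ℝ F x x ≤ 0) := by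
    intro x hx
    have hx0 : 0 < ‖x‖ := norm_pos_iff.2 hx.2
    have hxR : ‖x‖ < R := by simpa using hx.1
    have hs : (‖x‖ / R) ^ c < 1 := div_rpow_lt_one hR hc0 hx0.le hxR
    have ht : 0 < 1 - (‖x‖ / R) ^ c := sub_pos.2 hs
    obtain ⟨hvd, hvx⟩ := (hasDerivAt_radial_weight hR hc0 hx0 hxR a b).hasFDerivAt_comp_norm hx.2
    have hGx : fderiv ℝ G x x = F x * (‖x‖ ^ (-a) * (1 - (‖x‖ / R) ^ c) ^ (-b) *
        (-a * (1 - (‖x‖ / R) ^ c) + (b - 1) * c * (‖x‖ / R) ^ c)) +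
        (‖x‖ ^ (-a) * (1 - (‖x‖ / R) ^ c) ^ (1 - b)) * fderiv ℝ F x x := by
      have h := ((hFd x).hasFDerivAt.mul hvd.hasFDerivAt).fderiv
      rw [show G = F * fun y => v ‖y‖ from rfl, h]
      simp only [add_apply, smul_apply, smul_eq_mul]
      rw [hvx]
      simp only [smul_eq_mul]
      field_simp
    set W := ‖x‖ ^ (-a) * (1 - (‖x‖ / R) ^ c) ^ (-b) with hW
    have hW0 : 0 < W := by positivity
    have hvW : ‖x‖ ^ (-a) * (1 - (‖x‖ / R) ^ c) ^ (1 - b) = W * (1 - (‖x‖ / R) ^ c) := by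
      rw [show 1 - b = -b + 1 by ring, Real.rpow_add_one ht.ne', hW]
      ring
    have hΦx : Φ x = W * (((1 - (‖x‖ / R) ^ c) * (‖x‖ * ‖radDeriv f x‖)) ^ p -
        K ^ p * ‖f x‖ ^ p + K ^ (p - 1) * (‖f x‖ ^ p * ((n - a) * (1 - (‖x‖ / R) ^ c) +
          (b - 1) * c * (‖x‖ / R) ^ c) + (1 - (‖x‖ / R) ^ c) * fderiv ℝ F x x)) := by
      simp only [hΦ, hNu, hDe]
      rw [hGx, radial_weight_eq hx0 ht (norm_nonneg _), div_weight_eq hx0 ht, ← hW, hG]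
      simp only [hv, hF]
      rw [hvW]
      ring
    have key := hardy_pointwise_s4 (N := n) (K := K) hp hb hc0 hc hK hx0 hs (norm_nonneg (f x))
      (norm_nonneg (radDeriv f x))
      (abs_fderiv_norm_rpow_self_le hp (hf.differentiable one_ne_zero) x)
    rw [hΦx]
    exact ⟨mul_nonneg hW0.le key.1, fun h => key.2 ((mul_eq_zero.1 h).resolve_left hW0.ne')⟩
  have hΦ0 : 0 ≤ Φ := by
    intro x
    by_cases hx : x ∈ tsupport f
    · exact (hpt x (hft hx)).1
    · have h1 : fderiv ℝ G x = 0 := fderiv_of_notMem_tsupport ℝ fun h => hx (hGt h)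
      have h2 : G x = 0 := by simp [hG, hF0 x hx]
      simp [hΦ, hNu, hDe, h1, h2, radDeriv_eq_zero_of_notMem_tsupport hx,
        image_eq_zero_of_notMem_tsupport hx, Real.zero_rpow hp0.ne']
  by_contra! hle
  have hΦz : Φ = 0 := by
    have h1 : ∫ x, Φ x = 0 := le_antisymm (by rw [hΦint]; linarith) (integral_nonneg hΦ0)
    exact (hΦc.ae_eq_iff_eq volume continuous_const).1
      ((integral_eq_zero_iff_of_nonneg hΦ0 hΦi).1 h1)
  have hFz := eq_zero_of_fderiv_self_nonpos hFd (fun x => by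
    by_cases hx : x ∈ tsupport f
    · exact (hpt x (hft hx)).2 (congrFun hΦz x)
    · rw [fderiv_of_notMem_tsupport ℝ fun h => hx (hFt h)]
      simp) (hF0 0 fun h => (hft h).2 rfl) fun x => by positivity
  refine hf0 (funext fun x => ?_)
  simpa [hF, Real.rpow_eq_zero_iff_of_nonneg (norm_nonneg (f x)), hp0.ne'] using hFz x

/-- Integrals of functions of `s = (|x| / R) ^ c` reduce to one-dimensional integrals in `s`. -/
theorem exists_integral_comp_norm_div_rpow {n : ℕ} (hn : 1 ≤ n) {R c : ℝ} (hR : 0 < R)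
    (hc : 0 < c) : ∃ C : ℝ, 0 < C ∧ ∀ g : ℝ → ℝ,
      ∫ x : EuclideanSpace ℝ (Fin n), g ((‖x‖ / R) ^ c) =
        C * ∫ s in Set.Ioi (0 : ℝ), s ^ ((n : ℝ) / c - 1) * g s := by
  have : Nonempty (Fin n) := ⟨⟨0, hn⟩⟩
  set ω := (volume : Measure (EuclideanSpace ℝ (Fin n))).real (ball 0 1) with hω
  have hω0 : 0 < ω :=
    ENNReal.toReal_pos (measure_ball_pos _ _ one_pos).ne' measure_ball_lt_top.ne
  have hn0 : (0 : ℝ) < n := by exact_mod_cast hn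
  refine ⟨n * ω * (R * R ^ (n - 1)) / c, by positivity, fun g => ?_⟩
  have h1 := integral_fun_norm_addHaar (volume : Measure (EuclideanSpace ℝ (Fin n)))
    (fun r => g ((r / R) ^ c))
  simp only [finrank_euclideanSpace, Fintype.card_fin, smul_eq_mul, nsmul_eq_mul, ← hω] at h1
  have h2 := integral_comp_mul_left_Ioi (fun r => r ^ (n - 1) * g ((r / R) ^ c)) 0 hR
  rw [mul_zero] at h2
  have h3 := integral_comp_rpow_Ioi_of_pos (g := fun s => s ^ ((n : ℝ) / c - 1) * g s) hc
  have h4 : ∫ x in Set.Ioi (0 : ℝ), (R * x) ^ (n - 1) * g ((R * x / R) ^ c) =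
      R ^ (n - 1) / c * ∫ s in Set.Ioi (0 : ℝ), s ^ ((n : ℝ) / c - 1) * g s := by
    rw [← h3, ← integral_const_mul]
    refine setIntegral_congr_fun measurableSet_Ioi fun x hx => ?_
    have hx : 0 < x := hx
    have e1 : x ^ (c - 1) * (x ^ c) ^ ((n : ℝ) / c - 1) = x ^ (n - 1) := by
      rw [← Real.rpow_mul hx.le, ← Real.rpow_add hx, ← Real.rpow_natCast]
      congr 1
      push_cast [hn]
      field_simp
      ring
    have e2 : R * x / R = x := by field_simp
    simp only [e2, smul_eq_mul, mul_pow]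
    rw [← e1]
    field_simp
  rw [h4, smul_eq_mul] at h2
  rw [h1, show (∫ r in Set.Ioi (0 : ℝ), r ^ (n - 1) * g ((r / R) ^ c)) =
    R * (R⁻¹ * ∫ r in Set.Ioi (0 : ℝ), r ^ (n - 1) * g ((r / R) ^ c)) by field_simp, ← h2]
  field_simp

/-- A smooth step function that vanishes on `(-∞, 1]` and equals one on `[2, ∞)`. -/
noncomputable def smoothStep (y : ℝ) : ℝ := Real.smoothTransition (y - 1)

theorem contDiff_smoothStep : ContDiff ℝ 1 smoothStep :=
  (Real.smoothTransition.contDiff (n := 1)).comp (contDiff_id.sub contDiff_const)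

theorem smoothStep_nonneg (y : ℝ) : 0 ≤ smoothStep y := Real.smoothTransition.nonneg _

theorem smoothStep_le_one (y : ℝ) : smoothStep y ≤ 1 := Real.smoothTransition.le_one _

theorem smoothStep_eq_zero {y : ℝ} (hy : y ≤ 1) : smoothStep y = 0 :=
  Real.smoothTransition.zero_of_nonpos (by linarith)

theorem smoothStep_eq_one {y : ℝ} (hy : 2 ≤ y) : smoothStep y = 1 :=
  Real.smoothTransition.one_of_one_le (by linarith)

theorem deriv_smoothStep_eq_zero_of_le {y : ℝ} (hy : y ≤ 1) : deriv smoothStep y = 0 :=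
  IsLocalMin.deriv_eq_zero (Filter.Eventually.of_forall fun z => by
    rw [smoothStep_eq_zero hy]; exact smoothStep_nonneg z)

theorem deriv_smoothStep_eq_zero_of_ge {y : ℝ} (hy : 2 ≤ y) : deriv smoothStep y = 0 :=
  IsLocalMax.deriv_eq_zero (Filter.Eventually.of_forall fun z => by
    rw [smoothStep_eq_one hy]; exact smoothStep_le_one z)

theorem exists_abs_mul_deriv_smoothStep_le :
    ∃ M : ℝ, 0 ≤ M ∧ ∀ y, |y * deriv smoothStep y| ≤ M := by
  have hcont : Continuous fun y => y * deriv smoothStep y :=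
    continuous_id.mul (contDiff_smoothStep.continuous_deriv le_rfl)
  obtain ⟨M, hM⟩ := isCompact_Icc.exists_bound_of_continuousOn (s := Set.Icc (1 : ℝ) 2)
    hcont.continuousOn
  have hM0 : 0 ≤ M := (norm_nonneg _).trans (hM 1 (by simp))
  refine ⟨M, hM0, fun y => ?_⟩
  rcases le_total y 1 with h | h
  · simpa [deriv_smoothStep_eq_zero_of_le h]
  rcases le_total y 2 with h' | h'
  · exact hM y ⟨h, h'⟩
  · simpa [deriv_smoothStep_eq_zero_of_ge h']

/-- The power `(1 - s) ^ β`, cut off near `s = 0` and at distance `t` from `s = 1`. -/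
noncomputable def hardyProfile (β t s : ℝ) : ℝ :=
  (1 - s) ^ β * (smoothStep ((1 - s) / t) * smoothStep (4 * s))

theorem hardyProfile_eq_zero {β t s : ℝ} (ht : 0 < t) (hs : s ∉ Set.Ioo (1 / 4) (1 - t)) :
    hardyProfile β t s = 0 := by
  rw [hardyProfile]
  rcases le_or_gt s (1 / 4) with h | h
  · rw [smoothStep_eq_zero (y := 4 * s) (by linarith)]
    simp
  · have h' : 1 - t ≤ s := by
      by_contra! h'
      exact hs ⟨h, h'⟩
    rw [smoothStep_eq_zero (y := (1 - s) / t) ((div_le_one ht).2 (by linarith))]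
    simp

theorem tsupport_hardyProfile_subset {β t : ℝ} (ht : 0 < t) :
    tsupport (hardyProfile β t) ⊆ Set.Icc (1 / 4) (1 - t) :=
  closure_minimal (fun s hs => by
    by_contra h
    exact hs (hardyProfile_eq_zero ht fun h' => h (Set.Ioo_subset_Icc_self h'))) isClosed_Icc

theorem contDiff_hardyProfile {β t : ℝ} (ht : 0 < t) : ContDiff ℝ 1 (hardyProfile β t) := by
  refine contDiff_of_forall_mem_tsupport fun s hs => ?_
  have hs1 : 0 < 1 - s := by linarith [(tsupport_hardyProfile_subset ht hs).2]
  refine ((contDiffAt_const.sub contDiffAt_id).rpow_const_of_ne hs1.ne').mul (.mul ?_ ?_)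
  · exact contDiff_smoothStep.contDiffAt.comp s
      ((contDiffAt_const.sub contDiffAt_id).div_const t)
  · exact contDiff_smoothStep.contDiffAt.comp s (contDiffAt_const.mul contDiffAt_id)

theorem one_sub_mul_deriv_hardyProfile {β t s : ℝ} (hs : s < 1) :
    (1 - s) * deriv (hardyProfile β t) s =
      (1 - s) ^ β * (-β * (smoothStep ((1 - s) / t) * smoothStep (4 * s)) -
        (1 - s) / t * deriv smoothStep ((1 - s) / t) * smoothStep (4 * s) +
        (1 - s) * 4 * deriv smoothStep (4 * s) * smoothStep ((1 - s) / t)) := by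
  have hs1 : 0 < 1 - s := sub_pos.2 hs
  have hd (y : ℝ) : HasDerivAt smoothStep (deriv smoothStep y) y :=
    (contDiff_smoothStep.differentiable one_ne_zero y).hasDerivAt
  have h0 : HasDerivAt (fun s : ℝ => 1 - s) (-1) s := (hasDerivAt_id s).const_sub 1
  have h1 := h0.rpow_const (p := β) (Or.inl hs1.ne')
  have h2 := (hd ((1 - s) / t)).comp s (h0.div_const t)
  have h3 := (hd (4 * s)).comp s ((hasDerivAt_id s).const_mul 4)
  have h : HasDerivAt (hardyProfile β t) _ s := h1.mul (h2.mul h3)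
  rw [h.deriv, Real.rpow_sub_one hs1.ne']
  simp only [Function.comp_apply]
  field_simp
  ring

theorem exists_abs_one_sub_mul_deriv_hardyProfile_le {β : ℝ} (hβ : 0 ≤ β) :
    ∃ M : ℝ, 0 ≤ M ∧ ∀ t s : ℝ, 0 < s → s < 1 →
      |s * ((1 - s) * deriv (hardyProfile β t) s)| ≤ M * (1 - s) ^ β := by
  obtain ⟨M, hM0, hM⟩ := exists_abs_mul_deriv_smoothStep_le
  refine ⟨β + M + M, by positivity, fun t s hs0 hs1 => ?_⟩
  rw [one_sub_mul_deriv_hardyProfile hs1]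
  have hs1' : 0 < 1 - s := sub_pos.2 hs1
  have hpow : 0 ≤ (1 - s) ^ β := by positivity
  have ha0 := smoothStep_nonneg ((1 - s) / t)
  have ha1 := smoothStep_le_one ((1 - s) / t)
  have hb0 := smoothStep_nonneg (4 * s)
  have hb1 := smoothStep_le_one (4 * s)
  have hMa := hM ((1 - s) / t)
  have hMb := hM (4 * s)
  set α := smoothStep ((1 - s) / t)
  set γ := smoothStep (4 * s)
  set da := (1 - s) / t * deriv smoothStep ((1 - s) / t)
  have e1 : |s * (-β * (α * γ))| ≤ β := by
    rw [abs_mul, abs_mul, abs_neg, abs_of_pos hs0, abs_of_nonneg hβ,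
      abs_of_nonneg (mul_nonneg ha0 hb0)]
    have h1 : s * (α * γ) ≤ 1 :=
      mul_le_one₀ hs1.le (mul_nonneg ha0 hb0) (mul_le_one₀ ha1 hb0 hb1)
    nlinarith
  have e2 : |s * (da * γ)| ≤ M := by
    rw [abs_mul, abs_mul, abs_of_pos hs0, abs_of_nonneg hb0]
    have h1 : s * γ ≤ 1 := mul_le_one₀ hs1.le hb0 hb1
    nlinarith [abs_nonneg da]
  have e3 : |s * ((1 - s) * 4 * deriv smoothStep (4 * s) * α)| ≤ M := by
    rw [show s * ((1 - s) * 4 * deriv smoothStep (4 * s) * α) =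
      (4 * s * deriv smoothStep (4 * s)) * ((1 - s) * α) by ring, abs_mul,
      abs_of_nonneg (mul_nonneg hs1'.le ha0)]
    have h1 : (1 - s) * α ≤ 1 := mul_le_one₀ (by linarith) ha0 ha1
    exact (mul_le_of_le_one_right (abs_nonneg _) h1).trans hMb
  rw [show s * ((1 - s) ^ β * (-β * (α * γ) - da * γ +
      (1 - s) * 4 * deriv smoothStep (4 * s) * α)) = (s * (-β * (α * γ)) - s * (da * γ) +
      s * ((1 - s) * 4 * deriv smoothStep (4 * s) * α)) * (1 - s) ^ β by ring, abs_mul,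
    abs_of_nonneg hpow]
  gcongr
  exact (abs_add_le _ _).trans (add_le_add ((abs_sub _ _).trans (add_le_add e1 e2)) e3)

theorem exists_rpow_bounds (κ : ℝ) : ∃ A B : ℝ, 0 < A ∧ 0 < B ∧
    ∀ s ∈ Set.Icc (1 / 4 : ℝ) 1, A ≤ s ^ κ ∧ s ^ κ ≤ B := by
  have hc : ContinuousOn (fun s : ℝ => s ^ κ) (Set.Icc (1 / 4 : ℝ) 1) := fun s hs =>
    (Real.continuousAt_rpow_const s κ (Or.inl (by linarith [hs.1]))).continuousWithinAt
  have hne : (Set.Icc (1 / 4 : ℝ) 1).Nonempty := ⟨1, by norm_num⟩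
  obtain ⟨x, hx, hxm⟩ := isCompact_Icc.exists_isMinOn hne hc
  obtain ⟨y, hy, hym⟩ := isCompact_Icc.exists_isMaxOn hne hc
  exact ⟨x ^ κ, y ^ κ, Real.rpow_pos_of_pos (by linarith [hx.1]) _,
    Real.rpow_pos_of_pos (by linarith [hy.1]) _, fun s hs => ⟨hxm hs, hym hs⟩⟩

theorem weight_mul_rpow_mul_rpow {p b q s y M : ℝ} (hp : 0 < p) (hs : s < 1) (hM : 0 ≤ M)
    (hq : 0 ≤ q) (hy : |y| ≤ M * (1 - s) ^ ((b - 1) / p)) :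
    q * (1 - s) ^ (-b) * |y| ^ p ≤ M ^ p * (q * (1 - s)⁻¹) := by
  have hs1 : 0 < 1 - s := sub_pos.2 hs
  calc q * (1 - s) ^ (-b) * |y| ^ p
      ≤ q * (1 - s) ^ (-b) * (M * (1 - s) ^ ((b - 1) / p)) ^ p := by gcongr
    _ = M ^ p * (q * ((1 - s) ^ (-b) * (1 - s) ^ (b - 1))) := by
        rw [Real.mul_rpow hM (by positivity), ← Real.rpow_mul hs1.le, div_mul_cancel₀ _ hp.ne']
        ring
    _ = _ := by rw [← Real.rpow_add hs1, show -b + (b - 1) = -1 by ring, Real.rpow_neg_one]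

theorem integral_inv_one_sub {t : ℝ} (ht : 0 < t) (ht' : t ≤ 1 / 4) :
    ∫ s in (1 / 2 : ℝ)..(1 - 2 * t), (1 - s)⁻¹ = Real.log (1 / (4 * t)) := by
  rw [intervalIntegral.integral_comp_sub_left (fun s : ℝ => s⁻¹) 1,
    integral_inv_of_pos (by linarith) (by linarith)]
  congr 1
  field_simp
  ring

theorem continuous_profile_integrand {κ b p : ℝ} (hp : 0 < p) {t : ℝ} (ht : 0 < t) {g : ℝ → ℝ}
    (hg : Continuous g) (hg0 : ∀ s ∉ Set.Icc (1 / 4) (1 - t), g s = 0) :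
    Continuous (fun s : ℝ => s ^ κ * (1 - s) ^ b * |g s| ^ p) ∧
      HasCompactSupport (fun s : ℝ => s ^ κ * (1 - s) ^ b * |g s| ^ p) := by
  refine continuous_hasCompactSupport_of_continuousOn (K := Set.Icc (1 / 4) (1 - t))
    (U := Set.Ioo 0 1) isCompact_Icc isOpen_Ioo
    (fun s hs => ⟨by linarith [hs.1], by linarith [hs.2]⟩) ?_ ?_
  · intro s hs
    refine ContinuousAt.continuousWithinAt (.mul (.mul ?_ ?_) ?_)
    · exact Real.continuousAt_rpow_const s _ (Or.inl hs.1.ne')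
    · exact (continuousAt_const.sub continuousAt_id).rpow_const
        (Or.inl (sub_pos.2 hs.2).ne')
    · exact hg.abs.continuousAt.rpow_const (Or.inr hp.le)
  · intro s hs
    simp [hg0 s hs, Real.zero_rpow hp.ne']

theorem exists_hardyProfile_integral_lt {p b c κ ε : ℝ} (hp : 0 < p) (hb : 1 < b) (hc : 0 < c)
    (hε : 0 < ε) : ∃ t : ℝ, 0 < t ∧ t < 1 / 4 ∧
      ∫ s in Set.Ioi (0 : ℝ), s ^ κ * (1 - s) ^ (-b) *
          |(1 - s) * (c * s * deriv (hardyProfile ((b - 1) / p) t) s)| ^ p <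
        (((b - 1) * c / p) ^ p + ε) * ∫ s in Set.Ioi (0 : ℝ), s ^ κ * (1 - s) ^ (-b) *
          |hardyProfile ((b - 1) / p) t s| ^ p := by
  have hb' : 0 < b - 1 := sub_pos.2 hb
  set β := (b - 1) / p with hβ
  have hβ0 : 0 < β := by positivity
  obtain ⟨M, hM0, hM⟩ := exists_abs_one_sub_mul_deriv_hardyProfile_le hβ0.le
  obtain ⟨A, B, hA, hB, hAB⟩ := exists_rpow_bounds κ
  set C₀ := (c * M) ^ p * (B * 3) with hC₀
  have hC₀0 : 0 ≤ C₀ := by positivity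
  set t := Real.exp (-(C₀ / (ε * A) + 1)) / 4 with ht
  have ht0 : 0 < t := by positivity
  have ht4 : t < 1 / 4 := by
    have : Real.exp (-(C₀ / (ε * A) + 1)) < 1 := by
      rw [Real.exp_lt_one_iff]
      have : 0 ≤ C₀ / (ε * A) := by positivity
      linarith
    linarith
  have hlog : Real.log (1 / (4 * t)) = C₀ / (ε * A) + 1 := by
    rw [ht, mul_div_cancel₀ _ (by norm_num), one_div, ← Real.exp_neg, neg_neg, Real.log_exp]
  refine ⟨t, ht0, ht4, ?_⟩
  set φ := hardyProfile β t with hφ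
  set K := (b - 1) * c / p with hK
  have hKβ : K = c * β := by rw [hK, hβ]; ring
  have hφC : ContDiff ℝ 1 φ := contDiff_hardyProfile ht0
  have hφt : tsupport φ ⊆ Set.Icc (1 / 4) (1 - t) := tsupport_hardyProfile_subset ht0
  have hφ0 : ∀ s ∉ Set.Icc (1 / 4) (1 - t), φ s = 0 := fun s hs =>
    image_eq_zero_of_notMem_tsupport fun h => hs (hφt h)
  have hdφ0 : ∀ s ∉ Set.Icc (1 / 4) (1 - t), deriv φ s = 0 := fun s hs =>
    deriv_of_notMem_tsupport fun h => hs (hφt h)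
  have hdφc : Continuous (deriv φ) := hφC.continuous_deriv le_rfl
  obtain ⟨hPc, hPs⟩ := continuous_profile_integrand (κ := κ) (b := -b) hp ht0 hφC.continuous hφ0
  obtain ⟨hQc, hQs⟩ := continuous_profile_integrand (κ := κ) (b := -b) hp ht0
    (g := fun s => (1 - s) * (c * s * deriv φ s)) (by fun_prop)
    (fun s hs => by simp [hdφ0 s hs])
  set P : ℝ → ℝ := fun s => s ^ κ * (1 - s) ^ (-b) * |φ s| ^ p with hP
  set Q : ℝ → ℝ := fun s =>
    s ^ κ * (1 - s) ^ (-b) * |(1 - s) * (c * s * deriv φ s)| ^ p with hQ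
  have hPi : Integrable P := hPc.integrable_of_hasCompactSupport hPs
  have hQi : Integrable Q := hQc.integrable_of_hasCompactSupport hQs
  have hP0 : ∀ s ∉ Set.Icc (1 / 4) (1 - t), P s = 0 := fun s hs => by
    simp [hP, hφ0 s hs, Real.zero_rpow hp.ne']
  have hQ0 : ∀ s ∉ Set.Icc (1 / 4) (1 - t), Q s = 0 := fun s hs => by
    simp [hQ, hdφ0 s hs, Real.zero_rpow hp.ne']
  have hIoi : ∀ s ∉ Set.Ioi (0 : ℝ), s ∉ Set.Icc (1 / 4) (1 - t) := fun s hs h => by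
    refine hs (show 0 < s from ?_)
    linarith [h.1]
  rw [setIntegral_eq_integral_of_forall_compl_eq_zero fun s hs => hP0 s (hIoi s hs),
    setIntegral_eq_integral_of_forall_compl_eq_zero fun s hs => hQ0 s (hIoi s hs)]
  have hPnn : ∀ s, 0 ≤ P s := fun s => by
    by_cases hs : s ∈ Set.Icc (1 / 4) (1 - t)
    · have : 0 < s := by linarith [hs.1]
      have : 0 < 1 - s := by linarith [hs.2]
      positivity
    · exact (hP0 s hs).ge
  -- the profile is an exact power between the two cut-off regions
  have hmid : ∀ s ∈ Set.Icc (1 / 2) (1 - 2 * t), P s = s ^ κ * (1 - s)⁻¹ ∧ Q s ≤ K ^ p * P s := by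
    intro s hs
    have hs0 : 0 < s := by linarith [hs.1]
    have hs1 : s < 1 := by linarith [hs.2]
    have hs1' : 0 < 1 - s := sub_pos.2 hs1
    have h4 : 2 ≤ 4 * s := by linarith [hs.1]
    have ht2 : 2 ≤ (1 - s) / t := (le_div_iff₀ ht0).2 (by linarith [hs.2])
    have hφs : φ s = (1 - s) ^ β := by
      simp [hφ, hardyProfile, smoothStep_eq_one h4, smoothStep_eq_one ht2]
    have hdφs : (1 - s) * deriv φ s = (1 - s) ^ β * -β := by
      rw [hφ, one_sub_mul_deriv_hardyProfile hs1]
      simp [smoothStep_eq_one h4, smoothStep_eq_one ht2, deriv_smoothStep_eq_zero_of_ge h4,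
        deriv_smoothStep_eq_zero_of_ge ht2]
    have hPs' : P s = s ^ κ * (1 - s)⁻¹ := by
      simp only [hP]
      rw [hφs, abs_of_pos (by positivity), ← Real.rpow_mul hs1'.le, hβ,
        div_mul_cancel₀ _ hp.ne', mul_assoc, ← Real.rpow_add hs1',
        show -b + (b - 1) = -1 by ring, Real.rpow_neg_one]
    refine ⟨hPs', ?_⟩
    rw [hPs']
    refine weight_mul_rpow_mul_rpow hp hs1 (by positivity) (by positivity) ?_
    rw [show (1 - s) * (c * s * deriv φ s) = c * s * ((1 - s) * deriv φ s) by ring, hdφs,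
      show c * s * ((1 - s) ^ β * -β) = -(s * (K * (1 - s) ^ β)) by rw [hKβ]; ring, abs_neg,
      abs_of_nonneg (by positivity)]
    exact mul_le_of_le_one_left (by positivity) hs1.le
  have hedge : ∀ s ∈ Set.Icc (1 / 4) (1 - t), Q s ≤ (c * M) ^ p * (B * (1 - s)⁻¹) := by
    intro s hs
    have hs0 : 0 < s := by linarith [hs.1]
    have hs1 : s < 1 := by linarith [hs.2]
    have hs1' : 0 < 1 - s := sub_pos.2 hs1
    refine (weight_mul_rpow_mul_rpow hp hs1 (M := c * M) (by positivity) (by positivity)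
      ?_).trans ?_
    · rw [show (1 - s) * (c * s * deriv φ s) = c * (s * ((1 - s) * deriv φ s)) by ring, abs_mul,
        abs_of_pos hc, mul_assoc]
      gcongr
      exact hM t s hs0 hs1
    · gcongr
      exact (hAB s ⟨hs.1, hs1.le⟩).2
  have hupper : ∫ s, Q s ≤ K ^ p * (∫ s, P s) + C₀ := by
    set ψ₁ : ℝ → ℝ := (Set.Icc (1 / 4) (1 / 2)).indicator fun _ => (c * M) ^ p * (B * 2)
    set ψ₂ : ℝ → ℝ := (Set.Icc (1 - 2 * t) (1 - t)).indicator fun _ => (c * M) ^ p * (B * t⁻¹)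
    have h1 : Integrable ψ₁ :=
      (integrable_indicator_iff measurableSet_Icc).2 (integrableOn_const (by simp))
    have h2 : Integrable ψ₂ :=
      (integrable_indicator_iff measurableSet_Icc).2 (integrableOn_const (by simp))
    have h1n : ∀ s, 0 ≤ ψ₁ s := Set.indicator_nonneg fun _ _ => by positivity
    have h2n : ∀ s, 0 ≤ ψ₂ s := Set.indicator_nonneg fun _ _ => by positivity
    have hle : ∀ s, Q s ≤ K ^ p * P s + (ψ₁ s + ψ₂ s) := by
      intro s
      have hKP : 0 ≤ K ^ p * P s := mul_nonneg (by positivity) (hPnn s)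
      by_cases hs : s ∈ Set.Icc (1 / 4) (1 - t)
      · have hs1' : 0 < 1 - s := by linarith [hs.2]
        rcases le_total s (1 / 2) with h | h
        · have : ψ₁ s = (c * M) ^ p * (B * 2) := Set.indicator_of_mem (Set.mem_Icc.2 ⟨hs.1, h⟩) _
          have h3 : Q s ≤ (c * M) ^ p * (B * 2) := by
            refine (hedge s hs).trans ?_
            gcongr
            exact inv_le_of_inv_le₀ (by norm_num) (by linarith)
          linarith [h2n s]
        · rcases le_total s (1 - 2 * t) with h' | h'
          · linarith [(hmid s ⟨h, h'⟩).2, h1n s, h2n s]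
          · have : ψ₂ s = (c * M) ^ p * (B * t⁻¹) := Set.indicator_of_mem (Set.mem_Icc.2 ⟨h', hs.2⟩) _
            have h3 : Q s ≤ (c * M) ^ p * (B * t⁻¹) := by
              refine (hedge s hs).trans ?_
              gcongr
              linarith [hs.2]
            linarith [h1n s]
      · rw [hQ0 s hs]
        linarith [h1n s, h2n s]
    refine (integral_mono hQi ((hPi.const_mul _).add (h1.add h2)) hle).trans ?_
    have h3 := integral_add (hPi.const_mul (K ^ p)) (h1.add h2)
    simp only [Pi.add_apply] at h3 ⊢
    rw [h3, integral_add h1 h2, integral_const_mul, integral_indicator_const _ measurableSet_Icc,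
      integral_indicator_const _ measurableSet_Icc, Real.volume_real_Icc_of_le (by norm_num),
      Real.volume_real_Icc_of_le (by linarith)]
    have e1 : (1 - t - (1 - 2 * t)) • ((c * M) ^ p * (B * t⁻¹)) = (c * M) ^ p * B := by
      rw [smul_eq_mul]
      field_simp
      ring
    have e2 : 0 ≤ (c * M) ^ p * B := by positivity
    rw [e1, smul_eq_mul, hC₀]
    linarith
  have hlower : A * (C₀ / (ε * A) + 1) ≤ ∫ s, P s := by
    rw [← hlog, ← integral_inv_one_sub ht0 ht4.le, ← intervalIntegral.integral_const_mul,
      intervalIntegral.integral_of_le (by linarith), ← integral_indicator measurableSet_Ioc]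
    refine integral_mono_of_nonneg (Filter.Eventually.of_forall ?_) hPi
      (Filter.Eventually.of_forall ?_)
    · refine Set.indicator_nonneg fun s hs => ?_
      have : 0 < 1 - s := by linarith [hs.2]
      positivity
    · refine Set.indicator_le' (fun s hs => ?_) fun s _ => hPnn s
      have : 0 < 1 - s := by linarith [hs.2]
      rw [(hmid s (Set.Ioc_subset_Icc_self hs)).1]
      gcongr
      exact (hAB s ⟨by linarith [hs.1], by linarith⟩).1
  have hfin : C₀ < ε * ∫ s, P s := by
    have h1 : ε * (A * (C₀ / (ε * A) + 1)) = C₀ + ε * A := by field_simp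
    have h2 := mul_le_mul_of_nonneg_left hlower hε.le
    have h3 : 0 < ε * A := by positivity
    linarith
  linarith

/-- The radial function with profile `φ` in the variable `s = (|x| / R) ^ c`. -/
theorem contDiff_radial_of_profile {n : ℕ} {R c t : ℝ} (hR : 0 < R) (hc : 0 < c) (ht : 0 < t)
    {φ : ℝ → ℝ} (hφ : ContDiff ℝ 1 φ) (hφ0 : ∀ s ∉ Set.Icc (1 / 4) (1 - t), φ s = 0) :
    ContDiff ℝ 1 (fun x : EuclideanSpace ℝ (Fin n) => (φ ((‖x‖ / R) ^ c) : ℂ)) ∧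
      HasCompactSupport (fun x : EuclideanSpace ℝ (Fin n) => (φ ((‖x‖ / R) ^ c) : ℂ)) ∧
      tsupport (fun x : EuclideanSpace ℝ (Fin n) => (φ ((‖x‖ / R) ^ c) : ℂ)) ⊆
        ball 0 R \ {0} := by
  have hcont : Continuous fun x : EuclideanSpace ℝ (Fin n) => (‖x‖ / R) ^ c :=
    (continuous_norm.div_const R).rpow_const fun _ => Or.inr hc.le
  set S : Set (EuclideanSpace ℝ (Fin n)) :=
    (fun x => (‖x‖ / R) ^ c) ⁻¹' Set.Icc (1 / 4) (1 - t) with hS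
  have hSc : IsClosed S := isClosed_Icc.preimage hcont
  have hSb : S ⊆ ball 0 R \ {0} := by
    intro x hx
    constructor
    · rw [mem_ball_zero_iff]
      by_contra! h
      have : 1 ≤ (‖x‖ / R) ^ c := Real.one_le_rpow ((one_le_div hR).2 h) hc.le
      linarith [hx.2]
    · rintro rfl
      have h := hx.1
      norm_num [Real.zero_rpow hc.ne'] at h
  have ht' : tsupport (fun x : EuclideanSpace ℝ (Fin n) => (φ ((‖x‖ / R) ^ c) : ℂ)) ⊆ S :=
    closure_minimal (fun x hx => by
      by_contra h
      exact hx (by simp [hφ0 _ h])) hSc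
  refine ⟨contDiff_of_forall_mem_tsupport fun x hx => ?_, ?_, ht'.trans hSb⟩
  · have hx0 := (hSb (ht' hx)).2
    have hn0 : 0 < ‖x‖ := norm_pos_iff.2 hx0
    have hn : ContDiffAt ℝ 1 (fun x : EuclideanSpace ℝ (Fin n) => ‖x‖) x := contDiffAt_norm ℝ hx0
    exact Complex.ofRealCLM.contDiff.contDiffAt.comp x
      (hφ.contDiffAt.comp x ((hn.div_const R).rpow_const_of_ne (by positivity)))
  · refine HasCompactSupport.of_support_subset_isCompact
      (K := closedBall 0 R) (isCompact_closedBall 0 R) fun x hx => ?_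
    exact ball_subset_closedBall (hSb (ht' (subset_tsupport _ hx))).1

theorem norm_mul_norm_radDeriv_of_profile {n : ℕ} {R c : ℝ} (hR : 0 < R)
    {φ : ℝ → ℝ} (hφ : Differentiable ℝ φ) {x : EuclideanSpace ℝ (Fin n)} (hx : x ≠ 0) :
    ‖x‖ * ‖radDeriv (fun x : EuclideanSpace ℝ (Fin n) => (φ ((‖x‖ / R) ^ c) : ℂ)) x‖ =
      |c * (‖x‖ / R) ^ c * deriv φ ((‖x‖ / R) ^ c)| := by
  have hx0 : 0 < ‖x‖ := norm_pos_iff.2 hx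
  have h1 := ((hφ ((‖x‖ / R) ^ c)).hasDerivAt.comp ‖x‖ (hasDerivAt_div_rpow c hR hx0)).ofReal_comp
  have h2 := (h1.hasFDerivAt_comp_norm hx).2
  have h3 := fderiv_self_eq_norm_mul_radDeriv
    (fun x : EuclideanSpace ℝ (Fin n) => (φ ((‖x‖ / R) ^ c) : ℂ)) x
  have h4 := congrArg norm (h3.symm.trans h2)
  rw [norm_mul, norm_smul, Complex.norm_real, Complex.norm_real, Real.norm_eq_abs,
    Real.norm_eq_abs, abs_norm, ← abs_norm x, ← abs_mul, abs_norm] at h4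
  rw [h4]
  congr 1
  field_simp

theorem exists_unified_hardy_lt {n : ℕ} (hn : 1 ≤ n) {R : ℝ} (hR : 0 < R) {p b a c : ℝ}
    (hp : 1 < p) (hb : 1 < b) (hc : 0 < c) {ε : ℝ} (hε : 0 < ε) :
    ∃ f : EuclideanSpace ℝ (Fin n) → ℂ,
      ContDiff ℝ 1 f ∧ HasCompactSupport f ∧
      tsupport f ⊆ ball (0 : EuclideanSpace ℝ (Fin n)) R \ {0} ∧ f ≠ 0 ∧
      IntegrableOn (fun x =>
        ‖radDeriv f x‖ ^ p / (‖x‖ ^ (a - p) * (1 - (‖x‖ / R) ^ c) ^ (b - p)))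
        (ball (0 : EuclideanSpace ℝ (Fin n)) R) ∧
      (∫ x in ball (0 : EuclideanSpace ℝ (Fin n)) R,
          ‖radDeriv f x‖ ^ p / (‖x‖ ^ (a - p) * (1 - (‖x‖ / R) ^ c) ^ (b - p))) <
        (((b - 1) * c / p) ^ p + ε) *
          ∫ x in ball (0 : EuclideanSpace ℝ (Fin n)) R,
            ‖f x‖ ^ p / (‖x‖ ^ a * (1 - (‖x‖ / R) ^ c) ^ b) := by
  have hp0 : 0 < p := by linarith
  obtain ⟨C, hC, hCint⟩ := exists_integral_comp_norm_div_rpow hn hR hc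
  obtain ⟨t, ht0, ht4, hlt⟩ :=
    exists_hardyProfile_integral_lt (κ := (n : ℝ) / c - 1 + -a / c) hp0 hb hc hε
  set φ := hardyProfile ((b - 1) / p) t with hφ
  have hφC : ContDiff ℝ 1 φ := contDiff_hardyProfile ht0
  have hφt : tsupport φ ⊆ Set.Icc (1 / 4) (1 - t) := tsupport_hardyProfile_subset ht0
  have hφ0 : ∀ s ∉ Set.Icc (1 / 4) (1 - t), φ s = 0 := fun s hs =>
    image_eq_zero_of_notMem_tsupport fun h => hs (hφt h)
  obtain ⟨hfC, hfs, hft⟩ := contDiff_radial_of_profile (n := n) hR hc ht0 hφC hφ0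
  set f : EuclideanSpace ℝ (Fin n) → ℂ := fun x => (φ ((‖x‖ / R) ^ c) : ℂ) with hf
  obtain ⟨hNc, hNs⟩ := continuous_hardy_numerator (a := a) (b := b) hR hp0 hc hfC hfs hft
  have hout : ∀ x ∉ ball (0 : EuclideanSpace ℝ (Fin n)) R, x ∉ tsupport f :=
    fun x hx h => hx (hft h).1
  have hweight : ∀ x ∈ ball (0 : EuclideanSpace ℝ (Fin n)) R \ {0},
      ‖x‖ ^ (-a) = R ^ (-a) * ((‖x‖ / R) ^ c) ^ (-a / c) := by
    intro x hx
    have hx0 : 0 < ‖x‖ := norm_pos_iff.2 hx.2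
    rw [← Real.rpow_mul (by positivity), mul_div_cancel₀ _ hc.ne',
      ← Real.mul_rpow hR.le (by positivity), mul_div_cancel₀ _ hR.ne']
  have hzero : ∀ x ∉ ball (0 : EuclideanSpace ℝ (Fin n)) R \ {0},
      (‖x‖ / R) ^ c ∉ Set.Icc (1 / 4) (1 - t) := by
    intro x hx h
    refine hx ⟨?_, ?_⟩
    · rw [mem_ball_zero_iff]
      by_contra! h'
      have : 1 ≤ (‖x‖ / R) ^ c := Real.one_le_rpow ((one_le_div hR).2 h') hc.le
      linarith [h.2]
    · rintro rfl
      have h' := h.1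
      norm_num [Real.zero_rpow hc.ne'] at h'
  have hD : ∀ x, ‖f x‖ ^ p / (‖x‖ ^ a * (1 - (‖x‖ / R) ^ c) ^ b) =
      (fun s => R ^ (-a) * (s ^ (-a / c) * (1 - s) ^ (-b) * |φ s| ^ p)) ((‖x‖ / R) ^ c) := by
    intro x
    by_cases hx : x ∈ ball (0 : EuclideanSpace ℝ (Fin n)) R \ {0}
    · have hx0 : 0 < ‖x‖ := norm_pos_iff.2 hx.2
      have hs := div_rpow_lt_one hR hc hx0.le (by simpa using hx.1)
      rw [div_weight_eq hx0 (sub_pos.2 hs), hweight x hx]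
      simp only [hf, Complex.norm_real, Real.norm_eq_abs]
      ring
    · simp [image_eq_zero_of_notMem_tsupport fun h => hx (hft h), hφ0 _ (hzero x hx),
        Real.zero_rpow hp0.ne']
  have hN : ∀ x, ‖radDeriv f x‖ ^ p / (‖x‖ ^ (a - p) * (1 - (‖x‖ / R) ^ c) ^ (b - p)) =
      (fun s => R ^ (-a) * (s ^ (-a / c) * (1 - s) ^ (-b) *
        |(1 - s) * (c * s * deriv φ s)| ^ p)) ((‖x‖ / R) ^ c) := by
    intro x
    by_cases hx : x ∈ ball (0 : EuclideanSpace ℝ (Fin n)) R \ {0}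
    · have hx0 : 0 < ‖x‖ := norm_pos_iff.2 hx.2
      have hs := div_rpow_lt_one hR hc hx0.le (by simpa using hx.1)
      rw [radial_weight_eq hx0 (sub_pos.2 hs) (norm_nonneg _), hweight x hx, hf,
        norm_mul_norm_radDeriv_of_profile hR (hφC.differentiable one_ne_zero) hx.2]
      simp only
      rw [abs_mul (1 - _), abs_of_pos (sub_pos.2 hs)]
      ring
    · have h1 : deriv φ ((‖x‖ / R) ^ c) = 0 :=
        deriv_of_notMem_tsupport fun h => hzero x hx (hφt h)
      simp [radDeriv_eq_zero_of_notMem_tsupport fun h => hx (hft h), h1,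
        Real.zero_rpow hp0.ne']
  have hred : ∀ g : ℝ → ℝ,
      ∫ x : EuclideanSpace ℝ (Fin n),
        (fun s => R ^ (-a) * (s ^ (-a / c) * (1 - s) ^ (-b) * g s)) ((‖x‖ / R) ^ c) =
      C * R ^ (-a) * ∫ s in Set.Ioi (0 : ℝ),
        s ^ ((n : ℝ) / c - 1 + -a / c) * (1 - s) ^ (-b) * g s := by
    intro g
    refine (hCint fun s => R ^ (-a) * (s ^ (-a / c) * (1 - s) ^ (-b) * g s)).trans ?_
    rw [mul_assoc, ← integral_const_mul (R ^ (-a))]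
    congr 1
    refine setIntegral_congr_fun measurableSet_Ioi fun s hs => ?_
    have hs : 0 < s := hs
    simp only [Real.rpow_add hs]
    ring
  have hCR : 0 < C * R ^ (-a) := by positivity
  have hmain : (∫ x in ball (0 : EuclideanSpace ℝ (Fin n)) R,
      ‖radDeriv f x‖ ^ p / (‖x‖ ^ (a - p) * (1 - (‖x‖ / R) ^ c) ^ (b - p))) <
      (((b - 1) * c / p) ^ p + ε) * ∫ x in ball (0 : EuclideanSpace ℝ (Fin n)) R,
        ‖f x‖ ^ p / (‖x‖ ^ a * (1 - (‖x‖ / R) ^ c) ^ b) := by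
    rw [setIntegral_eq_integral_of_forall_compl_eq_zero fun x hx => by
        simp [radDeriv_eq_zero_of_notMem_tsupport (hout x hx), Real.zero_rpow hp0.ne'],
      setIntegral_eq_integral_of_forall_compl_eq_zero fun x hx => by
        simp [image_eq_zero_of_notMem_tsupport (hout x hx), Real.zero_rpow hp0.ne']]
    rw [integral_congr_ae (Filter.Eventually.of_forall hN),
      integral_congr_ae (Filter.Eventually.of_forall hD),
      hred fun s => |(1 - s) * (c * s * deriv φ s)| ^ p, hred fun s => |φ s| ^ p, mul_left_comm]
    exact mul_lt_mul_of_pos_left hlt hCR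
  refine ⟨f, hfC, hfs, hft, fun h0 => ?_,
    (hNc.integrable_of_hasCompactSupport hNs).integrableOn, hmain⟩
  rw [h0] at hmain
  have h1 : ∀ x : EuclideanSpace ℝ (Fin n), radDeriv (0 : EuclideanSpace ℝ (Fin n) → ℂ) x = 0 :=
    fun x => by simp [radDeriv]
  simp [h1, Real.zero_rpow hp0.ne'] at hmain

theorem unified_hardy_sharpness {n : ℕ} (hn : 1 ≤ n) {R : ℝ} (hR : 0 < R)
    {p b a c : ℝ} (hp : 1 < p) (hb : 1 < b) (ha : a < (n : ℝ))
    (hc0 : 0 < c) (hc : c ≤ ((n : ℝ) - a) / (b - 1)) :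
    (∀ ε : ℝ, 0 < ε →
      ∃ f : EuclideanSpace ℝ (Fin n) → ℂ,
        ContDiff ℝ 1 f ∧ HasCompactSupport f ∧
        tsupport f ⊆ ball (0 : EuclideanSpace ℝ (Fin n)) R \ {0} ∧ f ≠ 0 ∧
        IntegrableOn (fun x =>
          ‖radDeriv f x‖ ^ p / (‖x‖ ^ (a - p) * (1 - (‖x‖ / R) ^ c) ^ (b - p)))
          (ball (0 : EuclideanSpace ℝ (Fin n)) R) ∧
        (∫ x in ball (0 : EuclideanSpace ℝ (Fin n)) R,
            ‖radDeriv f x‖ ^ p / (‖x‖ ^ (a - p) * (1 - (‖x‖ / R) ^ c) ^ (b - p))) <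
          (((b - 1) * c / p) ^ p + ε) *
            ∫ x in ball (0 : EuclideanSpace ℝ (Fin n)) R,
              ‖f x‖ ^ p / (‖x‖ ^ a * (1 - (‖x‖ / R) ^ c) ^ b)) ∧
    (∀ f : EuclideanSpace ℝ (Fin n) → ℂ,
      ContDiff ℝ 1 f → HasCompactSupport f →
      tsupport f ⊆ ball (0 : EuclideanSpace ℝ (Fin n)) R \ {0} → f ≠ 0 →
      IntegrableOn (fun x =>
          ‖radDeriv f x‖ ^ p / (‖x‖ ^ (a - p) * (1 - (‖x‖ / R) ^ c) ^ (b - p)))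
          (ball (0 : EuclideanSpace ℝ (Fin n)) R) →
      ((b - 1) * c / p) ^ p *
        (∫ x in ball (0 : EuclideanSpace ℝ (Fin n)) R,
          ‖f x‖ ^ p / (‖x‖ ^ a * (1 - (‖x‖ / R) ^ c) ^ b)) <
      ∫ x in ball (0 : EuclideanSpace ℝ (Fin n)) R,
          ‖radDeriv f x‖ ^ p / (‖x‖ ^ (a - p) * (1 - (‖x‖ / R) ^ c) ^ (b - p))) := by
  refine ⟨fun ε hε => exists_unified_hardy_lt hn hR hp hb hc0 hε,
    fun f hf hfs hft hf0 _ => unified_hardy_strict hR hp hb hc0 ?_ hf hfs hft hf0⟩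
  rw [mul_comm]
  exact (le_div_iff₀ (sub_pos.2 hb)).1 hc
end
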